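/- arXiv:2111.13200 — 3 statements merged into one kernel-verified Lean document; each statement's English description precedes it below -/
import Mathlib

section
/- Let κ be a kernel on S and for each N ∈ ℕ let κ_N be a kernel on S, with κ_N(r,s) → κ(r,s) as N → ∞ for all r, s ∈ S. Fix y ∈ [0,1]^S with y ≠ 0 and a sequence k^{(N)} ∈ ℕ₀^S with k_r^{(N)}/N → y_r for every r ∈ S. Then limsup_{N→∞} (1/N) log p_N(k^{(N)}) ≤ ∑_{r∈S} y_r log(1 − e^{−(κy)_r}), where the right-hand side equals −∞ if y_r > 0 and (κy)_r = 0 for some r (convention log 0 = −∞), and (1/N) log p_N(k^{(N)}) is interpreted as −∞ when p_N(k^{(N)}) = 0. -/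
open scoped Classical ENNReal
open Filter MeasureTheory

noncomputable section

/-- The set of ordered pairs `(i,j)` of vertices with `i < j`, representing the
potential edges of a graph on `Fin n`. -/
def upperPairs (n : ℕ) : Finset (Fin n × Fin n) :=
  Finset.univ.filter fun q => q.1 < q.2

/-- The simple graph on `Fin n` determined by a finite set of (ordered) edges. -/
def graphOf {n : ℕ} (E : Finset (Fin n × Fin n)) : SimpleGraph (Fin n) :=
  SimpleGraph.fromRel fun i j => (i, j) ∈ E

/-- `PConn n x p` is the probability that the inhomogeneous random graph `G(n, x, p)`,
with type vector `x` and independent edges where `{i,j}` is present with probability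
`p (x i) (x j)`, is connected; written as a finite sum over connected graphs. -/
def PConn {S : Type*} (n : ℕ) (x : Fin n → S) (p : S → S → ℝ) : ℝ :=
  ∑ E ∈ (upperPairs n).powerset.filter (fun E => (graphOf E).Connected),
    (∏ q ∈ E, p (x q.1) (x q.2)) * ∏ q ∈ upperPairs n \ E, (1 - p (x q.1) (x q.2))

/-- Sum over all spanning trees (connected graphs with `n - 1` edges) on `Fin n` of the
product of the kernel over the edges. -/
def treeWeight {S : Type*} (n : ℕ) (x : Fin n → S) (κ : S → S → ℝ) : ℝ :=
  ∑ E ∈ (upperPairs n).powerset.filter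
      (fun E => (graphOf E).Connected ∧ E.card + 1 = n),
    ∏ q ∈ E, κ (x q.1) (x q.2)

/-- A canonical list of types compatible with the multiplicity vector `k`. -/
def compatList {S : Type*} [Fintype S] (k : S → ℕ) : List S :=
  (∑ s : S, (k s) • ({s} : Multiset S)).toList

lemma compatList_length {S : Type*} [Fintype S] (k : S → ℕ) :
    (compatList k).length = ∑ s : S, k s := by
  simp [compatList]

/-- A canonical type vector compatible with `k`, i.e. with `∑ i δ_{x i} = k`. -/
def compatVec {S : Type*} [Fintype S] (k : S → ℕ) : Fin (∑ s : S, k s) → S :=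
  fun i => (compatList k).get (Fin.cast (compatList_length k).symm i)

/-- `tau κ k` is the spanning-tree weight `τ(k; κ)`. -/
def tau {S : Type*} [Fintype S] (κ : S → S → ℝ) (k : S → ℕ) : ℝ :=
  treeWeight (∑ s : S, k s) (compatVec k) κ

/-- `pN κN N k` is the probability that the inhomogeneous random graph on a vertex set
with type composition `k` and edge probabilities `min 1 (κN/N)` is connected. -/
def pN {S : Type*} [Fintype S] (κN : S → S → ℝ) (N : ℕ) (k : S → ℕ) : ℝ :=
  PConn (∑ s : S, k s) (compatVec k) fun r s => min 1 (κN r s / N)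

/-- Extended-real logarithm, with `elog x = -∞` for `x ≤ 0`. -/
def elog (x : ℝ) : EReal := if x ≤ 0 then (⊥ : EReal) else ((Real.log x : ℝ) : EReal)

/-- The nonnegative part of `-log u`, equal to `∞` if `u ≤ 0`. -/
def negLogPart (u : ℝ) : ℝ≥0∞ := if u ≤ 0 then ⊤ else ENNReal.ofReal (-Real.log u)

/-- The relative-entropy summand `x log (x / d)` with conventions `0 log 0 = 0` and
`x log (x/0) = +∞` for `x ≠ 0`. -/
def entTerm (x d : ℝ) : EReal :=
  if x = 0 then (0 : EReal) else if d ≤ 0 then (⊤ : EReal)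
  else ((x * Real.log (x / d) : ℝ) : EReal)

/-- `‖κ‖_∞ = max_{r,s} κ r s`. -/
def kernelSup {S : Type*} [Fintype S] [Nonempty S] (κ : S → S → ℝ) : ℝ :=
  Finset.univ.sup' Finset.univ_nonempty fun r =>
    Finset.univ.sup' Finset.univ_nonempty fun s => κ r s

/-- `Σ(κ, ν)`, the `ℓ²(ν)`-operator norm of the matrix `(κ r s * ν s)_{r,s}`. -/
def sigmaOp {S : Type*} [Fintype S] (κ : S → S → ℝ) (ν : S → ℝ) : ℝ :=
  sSup { t : ℝ | ∃ f : S → ℝ, (∀ s, 0 ≤ f s) ∧ (∑ r : S, ν r * f r ^ 2) ≤ 1 ∧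
    t = Real.sqrt (∑ r : S, ν r * (∑ s : S, κ r s * f s * ν s) ^ 2) }

/-- Irreducibility of the kernel `κ` with respect to `ν`. -/
def Irred {S : Type*} (κ : S → S → ℝ) (ν : S → ℝ) : Prop :=
  ∀ A : Set S, (∀ r ∈ A, ∀ s, s ∉ A → 0 < ν r → 0 < ν s → κ r s = 0) →
    (∀ r ∈ A, ν r = 0) ∨ (∀ s, s ∉ A → ν s = 0)

/-- The generating series `Γ_r(θ) = ∑_k τ(k) k_r ∏_s θ_s^{k_s}/k_s! ∈ [0,∞]`. -/
def Gamma0 {S : Type*} [Fintype S] (κ : S → S → ℝ) (θ : S → ℝ) (r : S) : ℝ≥0∞ :=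
  ∑' k : S → ℕ,
    ENNReal.ofReal (tau κ k * (k r : ℝ) * ∏ s : S, θ s ^ (k s) / (Nat.factorial (k s) : ℝ))

/-- `χ(κ, θ)`: the infimum over probability vectors `w ≪ θ` of
`∑_r w_r log (w_r / ((κ w)_r θ_r))`. -/
def chiFn {S : Type*} [Fintype S] (κ : S → S → ℝ) (θ : S → ℝ) : EReal :=
  sInf { v : EReal | ∃ w : S → ℝ, (∀ r, 0 ≤ w r) ∧ ((∑ r : S, w r) = 1) ∧
    (∀ r, θ r = 0 → w r = 0) ∧
    v = ∑ r : S, entTerm (w r) ((∑ s : S, κ r s * w s) * θ r) }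

/-- `Δ_r(k)`: the sum over directed spanning trees of the support of `k` rooted at `r`
(encoded as parent maps `f`, edges `(f s, s)` directed away from the root) of
`∏ κ(f s, s) * k (f s)`. -/
def Delta {S : Type*} [Fintype S] [DecidableEq S] (κ : S → S → ℝ) (k : S → ℕ) (r : S) : ℝ :=
  ∑ f ∈ (Finset.univ : Finset (S → S)).filter (fun f =>
      (∀ s, (s = r ∨ k s = 0) → f s = s) ∧
      ∀ s, 0 < k s → s ≠ r → (0 < k (f s) ∧ ∃ n, f^[n] s = r)),
    ∏ s ∈ Finset.univ.filter (fun s => 0 < k s ∧ s ≠ r), (κ (f s) s * (k (f s) : ℝ))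

/-- The reference weight `τ(k) ∏_s μ_s^{k_s}/k_s!`. -/
def rhoMu {S : Type*} [Fintype S] (κ : S → S → ℝ) (μ : S → ℝ) (k : S → ℕ) : ℝ :=
  tau κ k * ∏ s : S, μ s ^ (k s) / (Nat.factorial (k s) : ℝ)

/-- The microscopic rate function `I_Mi`. -/
def IMi {S : Type*} [Fintype S] (κ : S → S → ℝ) (μ : S → ℝ) (lam : (S → ℕ) → ℝ) : EReal :=
  (∑' k : S → ℕ, entTerm (lam k) (rhoMu κ μ k))
  + ((∑' k : S → ℕ, lam k * (((∑ s : S, k s : ℕ) : ℝ) - 1) : ℝ) : EReal)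
  + ((((1 : ℝ)/2) * ∑ r : S, ∑ s : S, (∑' k : S → ℕ, lam k * (k r : ℝ)) * κ r s * μ s : ℝ) : EReal)

/-- The minimizer candidate `λ_k(c) = τ(k) ∏_s (c_s e^{-(κ c)_s})^{k_s}/k_s!`. -/
def lamC {S : Type*} [Fintype S] (κ : S → S → ℝ) (c : S → ℝ) (k : S → ℕ) : ℝ :=
  tau κ k * ∏ s : S, (c s * Real.exp (-(∑ t : S, κ s t * c t))) ^ (k s) / (Nat.factorial (k s) : ℝ)

/-- The mesoscopic rate function `I_Me`. -/
def IMe {S : Type*} [Fintype S] (κ : S → S → ℝ) (μ ν : S → ℝ) : EReal :=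
  (∑ r : S, entTerm (ν r) ((∑ s : S, κ r s * ν s) * μ r))
  + ((((1 : ℝ)/2) * ∑ r : S, ∑ s : S, ν r * κ r s * μ s : ℝ) : EReal)

/-- `b` is a solution of the fixed-point system for `c`:
`b ∈ [0,∞)^S`, `b ≤ c` and `(κ(c-b))_r b_r = c_r - b_r` for all `r`. -/
def IsFPSol {S : Type*} [Fintype S] (κ : S → S → ℝ) (c b : S → ℝ) : Prop :=
  (∀ r, 0 ≤ b r) ∧ (∀ r, b r ≤ c r) ∧
    ∀ r, (∑ s : S, κ r s * (c s - b s)) * b r = c r - b r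

/-- The macroscopic rate summand `f_Ma`. -/
def fMa {S : Type*} [Fintype S] (κ : S → S → ℝ) (μ y : S → ℝ) : EReal :=
  (∑ r : S, entTerm (y r) ((1 - Real.exp (-(∑ s : S, κ r s * y s))) * μ r))
  + ((((1 : ℝ)/2) * ∑ r : S, ∑ s : S, y r * κ r s * (μ s - y s) : ℝ) : EReal)

/-- The functional `G_c(b)`. -/
def Gc {S : Type*} [Fintype S] (κ : S → S → ℝ) (μ c b : S → ℝ) : EReal :=
  (((∑ r : S, b r * Real.log (b r / μ r))
      - (1/2) * ∑ r : S, ∑ s : S, b r * κ r s * b s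
      + (1/2) * ∑ r : S, ∑ s : S, c r * κ r s * μ s : ℝ) : EReal)
  + ∑ r : S, entTerm (c r - b r) ((∑ s : S, κ r s * (c s - b s)) * μ r)

/-- `λ_k(t) = t^{|k|-1} τ(k) e^{-t⟨k,κμ⟩} ∏_r μ_r^{k_r}/k_r!`. -/
def lamT {S : Type*} [Fintype S] (κ : S → S → ℝ) (μ : S → ℝ) (k : S → ℕ) (t : ℝ) : ℝ :=
  t ^ ((∑ s : S, k s) - 1) * tau κ k *
    Real.exp (-t * ∑ r : S, ∑ s : S, (k r : ℝ) * κ r s * μ s) *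
    ∏ r : S, μ r ^ (k r) / (Nat.factorial (k r) : ℝ)


def crossE {V : Type*} (T : Finset V) (q : V × V) : Prop :=
  (q.1 ∈ T ∧ q.2 ∉ T) ∨ (q.1 ∉ T ∧ q.2 ∈ T)

def incE {V : Type*} (v : V) (q : V × V) : Prop := q.1 = v ∨ q.2 = v

def evE {V : Type*} (U : Finset V) (E : Finset (V × V)) : Prop :=
  ∀ T ⊆ U, T.Nonempty → ∃ q ∈ E, crossE T q

def QE {V : Type*} (p : V × V → ℝ) (U : Finset V) (D : Finset (V × V)) : ℝ :=
  ∑ E ∈ D.powerset, if evE U E then (∏ q ∈ E, p q) * ∏ q ∈ D \ E, (1 - p q) else 0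

lemma c_mem {V : Type*} (p : V × V → ℝ) (h0 : ∀ q, 0 ≤ p q) (h1 : ∀ q, p q ≤ 1)
    (D : Finset (V × V)) : 0 ≤ ∏ q ∈ D, (1 - p q) ∧ ∏ q ∈ D, (1 - p q) ≤ 1 := by
  constructor
  · exact Finset.prod_nonneg fun q _ => by linarith [h1 q]
  · exact Finset.prod_le_one (fun q _ => by linarith [h1 q]) (fun q _ => by linarith [h0 q])

lemma QE_insert {V : Type*} (p : V × V → ℝ) (h0 : ∀ q, 0 ≤ p q) (h1 : ∀ q, p q ≤ 1)
    (U U' : Finset V) (D : Finset (V × V)) (e : V × V) (he : e ∉ D)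
    (hA : ∀ E, E ⊆ D → evE U (insert e E) → evE U' E) :
    QE p U (insert e D) ≤ p e * QE p U' D + (1 - p e) * QE p U D := by
  unfold QE
  rw [Finset.sum_powerset_insert he, add_comm, Finset.mul_sum, Finset.mul_sum]
  refine add_le_add (Finset.sum_le_sum fun E hE => ?_) (Finset.sum_le_sum fun E hE => ?_)
  all_goals
    have hED := Finset.mem_powerset.1 hE
    have heE : e ∉ E := fun h => he (hED h)
  · have hs : insert e D \ insert e E = D \ E := by
      ext q; simp only [Finset.mem_sdiff, Finset.mem_insert]
      constructor
      · tauto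
      · rintro ⟨a, b⟩; refine ⟨Or.inr a, ?_⟩; rintro (rfl | h) <;> tauto
    have hn : 0 ≤ p e * ((∏ q ∈ E, p q) * ∏ q ∈ D \ E, (1 - p q)) :=
      mul_nonneg (h0 e) (mul_nonneg (Finset.prod_nonneg fun q _ => h0 q) (c_mem p h0 h1 _).1)
    rw [hs, Finset.prod_insert heE]
    by_cases h : evE U (insert e E)
    · rw [if_pos h, if_pos (hA E hED h), mul_assoc]
    · rw [if_neg h]; split_ifs
      · exact hn
      · simp
  · have hs : insert e D \ E = insert e (D \ E) := Finset.insert_sdiff_of_notMem _ heE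
    rw [hs, Finset.prod_insert (by simp [he])]
    split_ifs
    · apply le_of_eq; ring
    · simp

lemma QE_le {V : Type*} (p : V × V → ℝ) (h0 : ∀ q, 0 ≤ p q) (h1 : ∀ q, p q ≤ 1) (n : ℕ) :
    ∀ (D : Finset (V × V)) (U : Finset V), D.card = n →
    QE p U D ≤ ∏ v ∈ U, (1 - ∏ q ∈ D.filter (incE v), (1 - p q)) := by
  induction n with
  | zero =>
    intro D U hD
    have : D = ∅ := Finset.card_eq_zero.1 hD
    subst this
    rcases U.eq_empty_or_nonempty with rfl | hU
    · simp [QE]; split_ifs <;> norm_num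
    · have : ¬ evE U (∅ : Finset (V × V)) := fun h => by simpa using h U subset_rfl hU
      simp only [QE, Finset.powerset_empty, Finset.sum_singleton, if_neg this]
      exact Finset.prod_nonneg fun v _ => by linarith [(c_mem p h0 h1 (Finset.filter (incE v) ∅)).2]
  | succ n ih =>
    intro D U hD
    by_cases hc : ∃ e ∈ D, crossE U e
    · obtain ⟨e, heD, hce⟩ := hc
      obtain ⟨u, hu, a, ha, hinc⟩ : ∃ u ∈ U, ∃ a, a ∉ U ∧ ∀ v, incE v e ↔ v = u ∨ v = a := by
        rcases hce with ⟨x, z⟩ | ⟨x, z⟩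
        · exact ⟨e.1, x, e.2, z, fun v => by unfold incE; tauto⟩
        · exact ⟨e.2, z, e.1, x, fun v => by unfold incE; tauto⟩
      set D' := D.erase e with hD'
      have hDi : insert e D' = D := Finset.insert_erase heD
      have heD' : e ∉ D' := Finset.notMem_erase e D
      have hcard : D'.card = n := by rw [hD', Finset.card_erase_of_mem heD, hD]; rfl
      have hstep := QE_insert p h0 h1 U (U.erase u) D' e heD' (by
        intro E hE hev T hT hTne
        obtain ⟨q, hq, hcr⟩ := hev T (hT.trans (Finset.erase_subset _ _)) hTne
        rcases Finset.mem_insert.1 hq with rfl | hq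
        · exfalso
          have hm : ∀ v, incE v q → v ∉ T := by
            intro v hv hvT
            have := Finset.mem_erase.1 (hT hvT)
            rcases (hinc v).1 hv with rfl | rfl
            · exact this.1 rfl
            · exact ha this.2
          rcases hcr with h | h
          · exact hm _ (Or.inl rfl) h.1
          · exact hm _ (Or.inr rfl) h.2
        · exact ⟨q, hq, hcr⟩)
      rw [hDi] at hstep
      have i1 := ih D' (U.erase u) hcard
      have i2 := ih D' U hcard
      have hoth : ∏ v ∈ U.erase u, (1 - ∏ q ∈ D.filter (incE v), (1 - p q))
          = ∏ v ∈ U.erase u, (1 - ∏ q ∈ D'.filter (incE v), (1 - p q)) := by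
        refine Finset.prod_congr rfl fun v hv => ?_
        have hv' := Finset.mem_erase.1 hv
        have : ¬ incE v e := by
          rw [hinc]; rintro (h | rfl)
          · exact hv'.1 h
          · exact ha hv'.2
        rw [← hDi, Finset.filter_insert, if_neg this]
      have huu : ∏ q ∈ D.filter (incE u), (1 - p q)
          = (1 - p e) * ∏ q ∈ D'.filter (incE u), (1 - p q) := by
        rw [← hDi, Finset.filter_insert, if_pos ((hinc u).2 (Or.inl rfl)),
          Finset.prod_insert (by simp [heD'])]
      rw [← Finset.mul_prod_erase _ _ hu, hoth, huu]
      rw [← Finset.mul_prod_erase _ _ hu] at i2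
      have j1 := mul_le_mul_of_nonneg_left i1 (h0 e)
      have j2 := mul_le_mul_of_nonneg_left i2 (show 0 ≤ 1 - p e by linarith [h1 e])
      refine (hstep.trans (add_le_add j1 j2)).trans (le_of_eq ?_)
      ring
    · push Not at hc
      rcases U.eq_empty_or_nonempty with rfl | hU
      · have hall : ∀ E, evE (∅ : Finset V) E := by
          intro E T hT hne
          rw [Finset.subset_empty.1 hT] at hne
          simp at hne
        simp only [QE, hall, if_true, Finset.prod_empty]
        rw [← Finset.prod_add]
        simp
      · have : QE p U D = 0 := by
          refine Finset.sum_eq_zero fun E hE => ?_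
          rw [if_neg]
          intro hev
          obtain ⟨q, hq, hcr⟩ := hev U subset_rfl hU
          exact hc q (Finset.mem_powerset.1 hE hq) hcr
        rw [this]
        exact Finset.prod_nonneg fun v _ => by linarith [(c_mem p h0 h1 (Finset.filter (incE v) D)).2]

lemma evE_of_connected {n : ℕ} (E : Finset (Fin n × Fin n)) (h : (graphOf E).Connected)
    (a : Fin n) : evE (Finset.univ.erase a) E := by
  intro T hT ⟨t, ht⟩
  have haT : a ∉ T := fun h => by simpa using hT h
  obtain ⟨w⟩ := h.preconnected t a
  obtain ⟨d, hd, h1, h2⟩ := w.exists_boundary_dart (T : Set (Fin n)) (by simpa using ht)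
    (by simpa using haT)
  have hadj := d.adj
  simp only [graphOf, SimpleGraph.fromRel_adj] at hadj
  rcases hadj.2 with h | h
  · exact ⟨_, h, Or.inl ⟨by simpa using h1, by simpa using h2⟩⟩
  · exact ⟨_, h, Or.inr ⟨by simpa using h2, by simpa using h1⟩⟩

lemma PConn_le {S : Type*} (n : ℕ) (x : Fin n → S) (p : S → S → ℝ) (hs : ∀ r s, p r s = p s r)
    (h0 : ∀ r s, 0 ≤ p r s) (h1 : ∀ r s, p r s ≤ 1) (a : Fin n) :
    PConn n x p ≤ ∏ v ∈ Finset.univ.erase a, (1 - ∏ w, (1 - p (x v) (x w))) := by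
  have h := QE_le (fun q : Fin n × Fin n => p (x q.1) (x q.2)) (fun _ => h0 _ _) (fun _ => h1 _ _)
    _ (upperPairs n) (Finset.univ.erase a) rfl
  refine le_trans ?_ (h.trans ?_)
  · unfold PConn QE
    rw [Finset.sum_filter]
    refine Finset.sum_le_sum fun E hE => ?_
    split_ifs with h2 h3
    · apply le_of_eq
      congr!
    · exact absurd (evE_of_connected E h2 a) h3
    · exact mul_nonneg (Finset.prod_nonneg fun _ _ => h0 _ _)
        (Finset.prod_nonneg fun _ _ => by linarith [h1 (x ‹Fin n × Fin n›.1) (x ‹Fin n × Fin n›.2)])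
    · rfl
  · refine Finset.prod_le_prod (fun v _ => ?_) (fun v _ => ?_)
    · linarith [(c_mem (fun q : Fin n × Fin n => p (x q.1) (x q.2)) (fun _ => h0 _ _)
        (fun _ => h1 _ _) ((upperPairs n).filter (incE v))).2]
    · apply sub_le_sub_left
      let oth : Fin n × Fin n → Fin n := fun q => if q.1 = v then q.2 else q.1
      have hinj : Set.InjOn oth ((upperPairs n).filter (incE v) : Finset (Fin n × Fin n)) := by
        rintro ⟨q1, q2⟩ hq ⟨r1, r2⟩ hr hqr
        simp only [upperPairs, incE, Finset.coe_filter, Finset.mem_filter, Finset.mem_univ,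
          true_and, Set.mem_ofPred_eq] at hq hr
        simp only [oth] at hqr
        simp only [Prod.mk.injEq]
        split_ifs at hqr <;> grind
      have : ∏ q ∈ (upperPairs n).filter (incE v), (1 - p (x q.1) (x q.2))
          = ∏ w ∈ ((upperPairs n).filter (incE v)).image oth, (1 - p (x v) (x w)) := by
        rw [Finset.prod_image hinj]
        refine Finset.prod_congr rfl fun q hq => ?_
        have := (Finset.mem_filter.1 hq).2
        simp only [oth]
        split_ifs with hh
        · rw [hh]
        · rcases this with h' | h'
          · exact absurd h' hh
          · rw [h', hs]
      rw [this]
      rw [← Finset.prod_sdiff (Finset.subset_univ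
        (((upperPairs n).filter (incE v)).image oth))]
      refine mul_le_of_le_one_left ?_ ?_
      · exact Finset.prod_nonneg fun w _ => by linarith [h1 (x v) (x w)]
      · exact Finset.prod_le_one (fun w _ => by linarith [h1 (x v) (x w)])
          (fun w _ => by linarith [h0 (x v) (x w)])

lemma compat_card {S : Type*} [Fintype S] (k : S → ℕ) (r : S) :
    (Finset.univ.filter fun i => compatVec k i = r).card = k r := by
  have h1 : (compatList k).count r = k r := by
    rw [← Multiset.coe_count, compatList, Multiset.coe_toList, Multiset.count_sum']
    simp [Multiset.count_nsmul, Multiset.count_singleton]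
  rw [← h1]
  have h2 : compatList k = List.ofFn (compatVec k) := by
    apply List.ext_get
    · simp [compatList_length]
    · intro n a b
      simp [compatVec]
  rw [h2, ← Multiset.coe_count, ← Fin.univ_val_map, Multiset.count_map, Finset.card_def,
    Finset.filter_val]
  simp only [eq_comm]

lemma pN_le {S : Type*} [Fintype S] (κ : S → S → ℝ) (hs : ∀ r s, κ r s = κ s r)
    (h0 : ∀ r s, 0 ≤ κ r s) (N : ℕ) (k : S → ℕ) :
    pN κ N k ≤ ∏ r, (1 - ∏ s, (1 - min 1 (κ r s / N)) ^ k s) ^ (k r - 1) := by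
  set p : S → S → ℝ := fun r s => min 1 (κ r s / N) with hp
  have p0 : ∀ r s, 0 ≤ p r s := fun r s => le_min zero_le_one (div_nonneg (h0 r s) (by positivity))
  have p1 : ∀ r s, p r s ≤ 1 := fun r s => min_le_left _ _
  have hc0 : ∀ r, 0 ≤ 1 - ∏ s, (1 - p r s) ^ k s := fun r => by
    have : ∏ s, (1 - p r s) ^ k s ≤ 1 := Finset.prod_le_one
      (fun s _ => pow_nonneg (by linarith [p1 r s]) _)
      (fun s _ => pow_le_one₀ (by linarith [p1 r s]) (by linarith [p0 r s]))
    linarith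
  have hc1 : ∀ r, 1 - ∏ s, (1 - p r s) ^ k s ≤ 1 := fun r => by
    have : 0 ≤ ∏ s, (1 - p r s) ^ k s := Finset.prod_nonneg
      (fun s _ => pow_nonneg (by linarith [p1 r s]) _)
    linarith
  by_cases hn : Nonempty (Fin (∑ s, k s))
  · obtain ⟨a⟩ := hn
    refine (PConn_le _ (compatVec k) p (fun r s => by simp [hp, hs r s]) p0 p1 a).trans ?_
    have e1 : ∀ v, ∏ w, (1 - p (compatVec k v) (compatVec k w))
        = ∏ s, (1 - p (compatVec k v) s) ^ k s := by
      intro v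
      rw [← Finset.prod_fiberwise Finset.univ (compatVec k)]
      refine Finset.prod_congr rfl fun s _ => ?_
      rw [Finset.prod_congr rfl (g := fun _ => 1 - p (compatVec k v) s), Finset.prod_const,
        compat_card]
      intro w hw
      rw [(Finset.mem_filter.1 hw).2]
    simp only [e1]
    rw [← Finset.prod_fiberwise (Finset.univ.erase a) (compatVec k)]
    refine Finset.prod_le_prod (fun s _ => Finset.prod_nonneg fun _ _ => hc0 _) fun r _ => ?_
    rw [Finset.prod_congr rfl (g := fun _ => 1 - ∏ s, (1 - p r s) ^ k s), Finset.prod_const]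
    · apply pow_le_pow_of_le_one (hc0 r) (hc1 r)
      rw [← compat_card k r, Finset.filter_erase]
      exact Finset.pred_card_le_card_erase
    · intro w hw
      rw [(Finset.mem_filter.1 hw).2]
  · have : pN κ N k = 0 := by
      unfold pN PConn
      rw [Finset.filter_false_of_mem, Finset.sum_empty]
      intro E _ h
      exact hn h.nonempty
    rw [this]
    exact Finset.prod_nonneg fun r _ => pow_nonneg (hc0 r) _

lemma factor_tendsto (a : ℕ → ℝ) (α : ℝ) (ha : Tendsto a atTop (nhds α)) (k : ℕ → ℕ) (y : ℝ)
    (hk : Tendsto (fun N => (k N : ℝ) / N) atTop (nhds y)) :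
    Tendsto (fun N : ℕ => (1 - min 1 (a N / N)) ^ k N) atTop (nhds (Real.exp (-(α * y)))) := by
  have hd : Tendsto (fun N : ℕ => a N / N) atTop (nhds 0) :=
    ha.div_atTop tendsto_natCast_atTop_atTop
  have hlt : ∀ᶠ N : ℕ in atTop, a N / N < 1 := hd.eventually_lt_const one_pos
  have h1 : Tendsto (fun N : ℕ => (1 + -(a N / N)) ^ N) atTop (nhds (Real.exp (-α))) := by
    apply Real.tendsto_one_add_pow_exp_of_tendsto
    refine ha.neg.congr' ?_
    filter_upwards [eventually_gt_atTop 0] with N hN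
    have : (N : ℝ) ≠ 0 := by positivity
    field_simp
  have h2 := h1.rpow hk (Or.inl (Real.exp_pos _).ne')
  rw [← Real.exp_mul] at h2
  rw [← neg_mul]
  refine h2.congr' ?_
  filter_upwards [eventually_gt_atTop 0, hlt] with N hN hl
  have hN' : (N : ℝ) ≠ 0 := by positivity
  rw [min_eq_right hl.le, ← sub_eq_add_neg, ← Real.rpow_natCast, ← Real.rpow_mul (by linarith),
    mul_div_cancel₀ _ hN', Real.rpow_natCast]

lemma elog_mono {a b : ℝ} (h : a ≤ b) : elog a ≤ elog b := by
  unfold elog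
  split_ifs with h1 h2
  · exact le_rfl
  · exact bot_le
  · exact absurd (h.trans ‹_›) h1
  · exact_mod_cast Real.log_le_log (not_le.1 h1) h

lemma ereal_coe_sum {S : Type*} (t : Finset S) (f : S → ℝ) :
    ((∑ r ∈ t, f r : ℝ) : EReal) = ∑ r ∈ t, (f r : EReal) := by
  induction t using Finset.induction_on with
  | empty => simp
  | insert a t ha ih => rw [Finset.sum_insert ha, Finset.sum_insert ha, EReal.coe_add, ih]

lemma key_limsup {S : Type*} [Fintype S]
    (κ : S → S → ℝ)
    (κN : ℕ → S → S → ℝ) (hκNsym : ∀ N r s, κN N r s = κN N s r)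
    (hκN0 : ∀ N r s, 0 ≤ κN N r s)
    (hκNconv : ∀ r s, Tendsto (fun N => κN N r s) atTop (nhds (κ r s)))
    (y : S → ℝ) (k : ℕ → S → ℕ)
    (hk : ∀ r, Tendsto (fun N => (k N r : ℝ) / N) atTop (nhds (y r)))
    (δ : S → ℝ) (hδ0 : ∀ r, 0 < δ r)
    (hδ : ∀ r, 1 - Real.exp (-(∑ s : S, κ r s * y s)) < δ r) :
    limsup (fun N : ℕ => ((N : ℝ)⁻¹ : EReal) * elog (pN (κN N) N (k N))) atTop
      ≤ ((∑ r, y r * Real.log (δ r) : ℝ) : EReal) := by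
  have hy0 : ∀ r, 0 ≤ y r := fun r => ge_of_tendsto' (hk r) fun N => by positivity
  have hg : ∀ r, ∀ᶠ N : ℕ in atTop,
      1 - ∏ s, (1 - min 1 (κN N r s / N)) ^ k N s < δ r := by
    intro r
    have : Tendsto (fun N : ℕ => 1 - ∏ s, (1 - min 1 (κN N r s / N)) ^ k N s) atTop
        (nhds (1 - Real.exp (-(∑ s : S, κ r s * y s)))) := by
      rw [← Finset.sum_neg_distrib, Real.exp_sum]
      exact (tendsto_finsetProd _ fun s _ => factor_tendsto _ _ (hκNconv r s) _ _ (hk s)).const_sub 1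
    exact this.eventually_lt_const (hδ r)
  have hm : ∀ r, Tendsto (fun N : ℕ => ((k N r - 1 : ℕ) : ℝ) / N) atTop (nhds (y r)) := by
    intro r
    have h1 : Tendsto (fun N : ℕ => (k N r : ℝ) / N - 1 / N) atTop (nhds (y r)) := by
      simpa using (hk r).sub (tendsto_one_div_atTop_nhds_zero_nat (𝕜 := ℝ))
    refine tendsto_of_tendsto_of_tendsto_of_le_of_le h1 (hk r) (fun N => ?_) (fun N => ?_)
    · simp only [← sub_div]
      apply div_le_div_of_nonneg_right _ (Nat.cast_nonneg N)
      rw [sub_le_iff_le_add]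
      have : k N r ≤ (k N r - 1) + 1 := by omega
      exact_mod_cast this
    · apply div_le_div_of_nonneg_right _ (Nat.cast_nonneg N)
      exact Nat.cast_le.2 (Nat.sub_le _ _)
  have hlim : Tendsto (fun N : ℕ => ((∑ r, ((k N r - 1 : ℕ) : ℝ) / N * Real.log (δ r) : ℝ) : EReal))
      atTop (nhds ((∑ r, y r * Real.log (δ r) : ℝ) : EReal)) := by
    apply (continuous_coe_real_ereal.tendsto _).comp
    exact tendsto_finsetSum _ fun r _ => (hm r).mul_const _
  rw [← hlim.limsup_eq]
  refine limsup_le_limsup ?_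
  filter_upwards [eventually_all.2 hg, eventually_gt_atTop 0] with N hN hpos
  have hb : pN (κN N) N (k N) ≤ ∏ r, δ r ^ (k N r - 1) := by
    refine (pN_le _ (hκNsym N) (hκN0 N) N (k N)).trans ?_
    refine Finset.prod_le_prod (fun r _ => pow_nonneg ?_ _) fun r _ => pow_le_pow_left₀ ?_ (hN r).le _
    all_goals
      have : ∏ s, (1 - min 1 (κN N r s / N)) ^ k N s ≤ 1 := Finset.prod_le_one
        (fun s _ => pow_nonneg (by linarith [min_le_left 1 (κN N r s / N)]) _)
        (fun s _ => pow_le_one₀ (by linarith [min_le_left 1 (κN N r s / N)])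
          (by linarith [le_min zero_le_one (div_nonneg (hκN0 N r s) (Nat.cast_nonneg (α := ℝ) N))]))
      linarith
  have hpp : 0 < ∏ r, δ r ^ (k N r - 1) := Finset.prod_pos fun r _ => pow_pos (hδ0 r) _
  have hNi : (0 : EReal) ≤ ((N : ℝ)⁻¹ : EReal) := by
    rw [← EReal.coe_inv]
    exact EReal.coe_nonneg.2 (inv_nonneg.2 (Nat.cast_nonneg (α := ℝ) N))
  refine (mul_le_mul_of_nonneg_left (elog_mono hb) hNi).trans (le_of_eq ?_)
  rw [elog, if_neg (not_le.2 hpp), Real.log_prod (fun r _ => (pow_pos (hδ0 r) _).ne')]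
  rw [← EReal.coe_inv, ← EReal.coe_mul]
  congr 1
  rw [Finset.mul_sum]
  refine Finset.sum_congr rfl fun r _ => ?_
  rw [Real.log_pow]; ring

/-- upper bound for connection probabilities of macroscopic clusters. -/
theorem macroscopic_connProb_upper
    {S : Type*} [Fintype S] [DecidableEq S] [Nonempty S]
    (κ : S → S → ℝ) (hκsym : ∀ r s, κ r s = κ s r) (hκ0 : ∀ r s, 0 ≤ κ r s)
    (κN : ℕ → S → S → ℝ) (hκNsym : ∀ N r s, κN N r s = κN N s r)
    (hκN0 : ∀ N r s, 0 ≤ κN N r s)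
    (hκNconv : ∀ r s, Tendsto (fun N => κN N r s) atTop (nhds (κ r s)))
    (y : S → ℝ) (hy0 : ∀ r, 0 ≤ y r) (hy1 : ∀ r, y r ≤ 1) (hyne : y ≠ 0)
    (k : ℕ → S → ℕ)
    (hk : ∀ r, Tendsto (fun N => (k N r : ℝ) / N) atTop (nhds (y r))) :
    limsup (fun N : ℕ => ((N : ℝ)⁻¹ : EReal) * elog (pN (κN N) N (k N))) atTop
      ≤ ∑ r : S, (y r : EReal) * elog (1 - Real.exp (-(∑ s : S, κ r s * y s))) := by
  have key := key_limsup κ κN hκNsym hκN0 hκNconv y k hk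
  set G : S → ℝ := fun r => 1 - Real.exp (-(∑ s : S, κ r s * y s)) with hG
  have hG0 : ∀ r, 0 ≤ G r := fun r => by
    have : 0 ≤ ∑ s : S, κ r s * y s := Finset.sum_nonneg fun s _ => mul_nonneg (hκ0 r s) (hy0 s)
    have := Real.exp_le_one_iff.2 (neg_nonpos.2 this)
    simp only [hG]; linarith
  have hG1 : ∀ r, G r < 1 := fun r => by
    have := Real.exp_pos (-(∑ s : S, κ r s * y s))
    simp only [hG]; linarith
  by_cases hA : ∀ r, 0 < y r → 0 < G r
  · have hR : ∑ r : S, (y r : EReal) * elog (G r) = ((∑ r, y r * Real.log (G r) : ℝ) : EReal) := by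
      rw [ereal_coe_sum]
      refine Finset.sum_congr rfl fun r _ => ?_
      rcases (hy0 r).eq_or_lt with h | h
      · simp [← h]
      · rw [elog, if_neg (not_le.2 (hA r h)), EReal.coe_mul]
    rw [hR]
    have hT : Tendsto (fun ε : ℝ => ((∑ r, y r * Real.log (G r + ε) : ℝ) : EReal))
        (nhdsWithin 0 (Set.Ioi 0)) (nhds ((∑ r, y r * Real.log (G r) : ℝ) : EReal)) := by
      apply (continuous_coe_real_ereal.tendsto _).comp
      refine tendsto_finsetSum _ fun r _ => ?_
      rcases (hy0 r).eq_or_lt with h | h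
      · simp [← h]
      · apply Tendsto.const_mul
        have h1 : Tendsto (fun ε : ℝ => G r + ε) (nhdsWithin 0 (Set.Ioi 0)) (nhds (G r)) := by
          have : Tendsto (fun ε : ℝ => G r + ε) (nhds 0) (nhds (G r + 0)) :=
            (continuous_const.add continuous_id).tendsto 0
          rw [add_zero] at this
          exact this.mono_left nhdsWithin_le_nhds
        exact h1.log (hA r h).ne'
    refine ge_of_tendsto hT ?_
    filter_upwards [self_mem_nhdsWithin] with ε hε
    have hε' : 0 < ε := hε
    exact key (fun r => G r + ε) (fun r => by linarith [hG0 r]) (fun r => by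
      change G r < G r + ε; linarith)
  · push Not at hA
    obtain ⟨r, hyr, hGr⟩ := hA
    have hb : limsup (fun N : ℕ => ((N : ℝ)⁻¹ : EReal) * elog (pN (κN N) N (k N))) atTop = ⊥ := by
      rw [EReal.eq_bot_iff_forall_lt]
      intro M
      let δ : S → ℝ := fun s => if s = r then Real.exp ((M - 1) / y r) else 1
      refine lt_of_le_of_lt (key δ (fun s => ?_) (fun s => ?_)) ?_
      · simp only [δ]; split_ifs
        · exact Real.exp_pos _
        · exact one_pos
      · change G s < δ s
        simp only [δ]; split_ifs with h
        · subst h; exact hGr.trans_lt (Real.exp_pos _)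
        · exact hG1 s
      · have : ∑ s, y s * Real.log (δ s) = M - 1 := by
          rw [Finset.sum_eq_single r]
          · simp only [δ, if_true, Real.log_exp]; field_simp
          · intro s _ hs; simp [δ, hs]
          · simp
        rw [this]
        exact_mod_cast sub_one_lt M
    rw [hb]; exact bot_le


end
end

section
/- Let κ be a kernel on S and for each N ∈ ℕ let κ_N be a kernel on S, with κ_N(r,s) → κ(r,s) as N → ∞ for all r, s ∈ S. Fix y ∈ [0,1]^S with y ≠ 0 and a sequence k^{(N)} ∈ ℕ₀^S with k_r^{(N)}/N → y_r for every r ∈ S. Assume that τ(k^{(N)};κ) > 0 for all but finitely many N, and that for every r ∈ S with y_r = 0 the sequence (k_r^{(N)})_N is bounded. Then lim_{N→∞} (1/N) log p_N(k^{(N)}) = ∑_{r∈S} y_r log(1 − e^{−(κy)_r}) ∈ [−∞, 0], the right-hand side taking the value −∞ exactly when y_r > 0 and (κy)_r = 0 for some r (convention log 0 = −∞). -/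
open scoped Classical ENNReal
open Filter MeasureTheory

noncomputable section

namespace MC

lemma coupling {α : Type*} [DecidableEq α] (p : α → ℝ) (Z : Finset α) :
    ∀ φ : Finset α → Finset α → ℝ,
    (∀ e ∈ Z, ∀ E F, E ⊆ Z → F ⊆ Z → e ∉ E → e ∉ F →
      φ (insert e E) (insert e F) + φ E F = φ (insert e E) F + φ E (insert e F)) →
    ∑ E ∈ Z.powerset, ((∏ q ∈ E, p q) * ∏ q ∈ Z \ E, (1 - p q)) * φ E E =
    ∑ E ∈ Z.powerset, ∑ F ∈ Z.powerset, ((∏ q ∈ E, p q) * ∏ q ∈ Z \ E, (1 - p q)) *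
      ((∏ q ∈ F, p q) * ∏ q ∈ Z \ F, (1 - p q)) * φ E F := by
  induction Z using Finset.induction_on with
  | empty => intro φ _; simp
  | insert e Z he ih =>
    intro φ hφ
    have key : ∀ ψ : Finset α → ℝ, ∑ E ∈ (insert e Z).powerset,
        ((∏ q ∈ E, p q) * ∏ q ∈ insert e Z \ E, (1 - p q)) * ψ E =
        ∑ E ∈ Z.powerset, ((∏ q ∈ E, p q) * ∏ q ∈ Z \ E, (1 - p q)) *
          (p e * ψ (insert e E) + (1 - p e) * ψ E) := by
      intro ψ
      rw [Finset.sum_powerset_insert he, ← Finset.sum_add_distrib]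
      refine Finset.sum_congr rfl fun E hE => ?_
      have hE' := Finset.mem_powerset.1 hE
      have heE : e ∉ E := fun h => he (hE' h)
      have h1 : insert e Z \ E = insert e (Z \ E) := Finset.insert_sdiff_of_notMem _ heE
      have h2 : insert e Z \ insert e E = Z \ E := by
        ext a; simp only [Finset.mem_sdiff, Finset.mem_insert]
        constructor
        · tauto
        · rintro ⟨ha, hb⟩
          refine ⟨Or.inr ha, ?_⟩
          rintro (rfl | h)
          · exact he ha
          · exact hb h
      have h3 : e ∉ Z \ E := fun h => he (Finset.mem_sdiff.1 h).1
      rw [h1, h2, Finset.prod_insert h3, Finset.prod_insert heE]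
      ring
    rw [key (fun E => φ E E)]
    rw [ih (fun E F => p e * φ (insert e E) (insert e F) + (1 - p e) * φ E F)]
    · have : ∀ E, ∑ F ∈ (insert e Z).powerset, ((∏ q ∈ E, p q) * ∏ q ∈ insert e Z \ E, (1 - p q)) *
          ((∏ q ∈ F, p q) * ∏ q ∈ insert e Z \ F, (1 - p q)) * φ E F =
          ((∏ q ∈ E, p q) * ∏ q ∈ insert e Z \ E, (1 - p q)) *
          ∑ F ∈ Z.powerset, ((∏ q ∈ F, p q) * ∏ q ∈ Z \ F, (1 - p q)) *
            (p e * φ E (insert e F) + (1 - p e) * φ E F) := by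
        intro E
        rw [← key (fun F => φ E F), Finset.mul_sum]
        exact Finset.sum_congr rfl fun F _ => by ring
      simp_rw [this]
      rw [key (fun E => ∑ F ∈ Z.powerset, ((∏ q ∈ F, p q) * ∏ q ∈ Z \ F, (1 - p q)) *
            (p e * φ E (insert e F) + (1 - p e) * φ E F))]
      refine Finset.sum_congr rfl fun E hE => ?_
      rw [Finset.mul_sum, Finset.mul_sum, ← Finset.sum_add_distrib, Finset.mul_sum]
      refine Finset.sum_congr rfl fun F hF => ?_
      have hE' := Finset.mem_powerset.1 hE
      have hF' := Finset.mem_powerset.1 hF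
      have := hφ e (Finset.mem_insert_self _ _) E F (hE'.trans (Finset.subset_insert _ _))
        (hF'.trans (Finset.subset_insert _ _)) (fun h => he (hE' h)) (fun h => he (hF' h))
      linear_combination ((∏ q ∈ E, p q) * ∏ q ∈ Z \ E, (1 - p q)) *
        ((∏ q ∈ F, p q) * ∏ q ∈ Z \ F, (1 - p q)) * p e * (1 - p e) * this
    · intro e' he' E F hE hF heE heF
      have hne : e' ≠ e := by rintro rfl; exact he he'
      have h1 := hφ e' (Finset.mem_insert_of_mem he') E F (hE.trans (Finset.subset_insert _ _))
        (hF.trans (Finset.subset_insert _ _)) heE heF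
      have h2 := hφ e' (Finset.mem_insert_of_mem he') (insert e E) (insert e F)
        (Finset.insert_subset_insert _ hE) (Finset.insert_subset_insert _ hF)
        (by simp [hne, heE]) (by simp [hne, heF])
      simp only [Finset.insert_comm e' e] at h2
      linear_combination p e * h2 + (1 - p e) * h1

lemma rtg_mono {V : Type*} {r s : V → V → Prop} (h : ∀ a b, r a b → s a b) {u v : V}
    (hv : Relation.ReflTransGen r u v) : Relation.ReflTransGen s u v := by
  induction hv with
  | refl => exact .refl
  | tail _ hbc ih => exact ih.tail (h _ _ hbc)

lemma add_arc {V : Type*} (r : V → V → Prop) (root i j : V)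
    (h : ¬ Relation.ReflTransGen r root i ∨ Relation.ReflTransGen r root j) (v : V) :
    Relation.ReflTransGen (fun a b => r a b ∨ (a = i ∧ b = j)) root v ↔
      Relation.ReflTransGen r root v := by
  constructor
  · intro hv
    induction hv with
    | refl => exact .refl
    | tail _ hbc ih =>
      rcases hbc with hbc | ⟨rfl, rfl⟩
      · exact ih.tail hbc
      · rcases h with h | h
        · exact absurd ih h
        · exact h
  · intro hv
    exact rtg_mono (fun a b hab => Or.inl hab) hv

/-- all vertices reachable -/
def RAll {V : Type*} (root : V) (r : V → V → Prop) : Prop :=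
  ∀ v, Relation.ReflTransGen r root v

def ind (P : Prop) : ℝ := if P then 1 else 0

lemma modular {V : Type*} (r : V → V → Prop) (root i j : V) :
    ind (RAll root (fun a b => (r a b ∨ (a = i ∧ b = j)) ∨ (a = j ∧ b = i))) + ind (RAll root r)
    = ind (RAll root (fun a b => r a b ∨ (a = i ∧ b = j)))
      + ind (RAll root (fun a b => r a b ∨ (a = j ∧ b = i))) := by
  have hsw : (fun a b => (r a b ∨ (a = i ∧ b = j)) ∨ (a = j ∧ b = i)) =
      (fun a b => (r a b ∨ (a = j ∧ b = i)) ∨ (a = i ∧ b = j)) := by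
    funext a b; apply propext; tauto
  have mono1 : ∀ v, Relation.ReflTransGen r root v →
      Relation.ReflTransGen (fun a b => r a b ∨ (a = i ∧ b = j)) root v :=
    fun v hv => rtg_mono (fun a b hab => Or.inl hab) hv
  have mono2 : ∀ v, Relation.ReflTransGen r root v →
      Relation.ReflTransGen (fun a b => r a b ∨ (a = j ∧ b = i)) root v :=
    fun v hv => rtg_mono (fun a b hab => Or.inl hab) hv
  by_cases hi : Relation.ReflTransGen r root i
  · have e2 : RAll root (fun a b => r a b ∨ (a = j ∧ b = i)) ↔ RAll root r :=
      forall_congr' (add_arc r root j i (Or.inr hi))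
    have e1 : RAll root (fun a b => (r a b ∨ (a = i ∧ b = j)) ∨ (a = j ∧ b = i)) ↔
        RAll root (fun a b => r a b ∨ (a = i ∧ b = j)) :=
      forall_congr' (add_arc _ root j i (Or.inr (mono1 _ hi)))
    simp only [ind, e1, e2]
  · rw [hsw]
    have e1 : RAll root (fun a b => r a b ∨ (a = i ∧ b = j)) ↔ RAll root r :=
      forall_congr' (add_arc r root i j (Or.inl hi))
    have e2 : RAll root (fun a b => (r a b ∨ (a = j ∧ b = i)) ∨ (a = i ∧ b = j)) ↔
        RAll root (fun a b => r a b ∨ (a = j ∧ b = i)) := by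
      refine forall_congr' (add_arc _ root i j ?_)
      by_cases hj : Relation.ReflTransGen r root j
      · exact Or.inr (mono2 _ hj)
      · left
        rw [add_arc r root j i (Or.inl hj)]
        exact hi
    simp only [ind, e1, e2]
    ring

lemma conn_iff {n : ℕ} (root : Fin n) (E : Finset (Fin n × Fin n)) :
    (graphOf E).Connected ↔ RAll root (fun a b => (a, b) ∈ E ∨ (b, a) ∈ E) := by
  have hadj : ∀ a b, (graphOf E).Adj a b ↔ a ≠ b ∧ ((a, b) ∈ E ∨ (b, a) ∈ E) := by
    intro a b; simp [graphOf, SimpleGraph.fromRel_adj]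
  have h : ∀ v, (graphOf E).Reachable root v ↔
      Relation.ReflTransGen (fun a b => (a, b) ∈ E ∨ (b, a) ∈ E) root v := by
    intro v
    rw [SimpleGraph.reachable_iff_reflTransGen]
    constructor
    · intro h; exact rtg_mono (fun a b hab => ((hadj a b).1 hab).2) h
    · intro h
      induction h with
      | refl => exact .refl
      | @tail b c _ hbc ih =>
        by_cases hh : b = c
        · subst hh; exact ih
        · exact ih.tail ((hadj _ _).2 ⟨hh, hbc⟩)
  constructor
  · intro hc v; exact (h v).1 (hc.preconnected root v)
  · intro hr
    have : Nonempty (Fin n) := ⟨root⟩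
    exact ⟨fun u v => ((h u).2 (hr u)).symm.trans ((h v).2 (hr v))⟩

lemma PConn_dir {S : Type*} (n : ℕ) (root : Fin n) (x : Fin n → S) (p : S → S → ℝ) :
    PConn n x p = ∑ E ∈ (upperPairs n).powerset, ∑ F ∈ (upperPairs n).powerset,
      ((∏ q ∈ E, p (x q.1) (x q.2)) * ∏ q ∈ upperPairs n \ E, (1 - p (x q.1) (x q.2))) *
      ((∏ q ∈ F, p (x q.1) (x q.2)) * ∏ q ∈ upperPairs n \ F, (1 - p (x q.1) (x q.2))) *
      ind (RAll root (fun a b => (a, b) ∈ E ∨ (b, a) ∈ F)) := by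
  rw [← coupling (fun q : Fin n × Fin n => p (x q.1) (x q.2)) (upperPairs n)
    (fun E F => ind (RAll root (fun a b => (a, b) ∈ E ∨ (b, a) ∈ F)))]
  · rw [PConn, Finset.sum_filter]
    refine Finset.sum_congr rfl fun E _ => ?_
    rw [ind, ← conn_iff root E]
    split_ifs <;> simp
  · rintro ⟨i, j⟩ _ E F _ _ _ _
    have := modular (fun a b => (a, b) ∈ E ∨ (b, a) ∈ F) root i j
    convert this using 4 <;> · funext a b; apply propext; simp [Prod.ext_iff]; try tauto

end MC

namespace MC

/-- in-neighbourhood weight -/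
def wt {V : Type*} [Fintype V] [DecidableEq V] (P : V → V → ℝ) (v : V) (A : Finset V) : ℝ :=
  ∏ a ∈ Finset.univ.erase v, if a ∈ A then P a v else 1 - P a v

lemma prod_ite_sub {α : Type*} [DecidableEq α] (Z E : Finset α) (hE : E ⊆ Z) (f g : α → ℝ) :
    (∏ q ∈ E, f q) * ∏ q ∈ Z \ E, g q = ∏ q ∈ Z, if q ∈ E then f q else g q := by
  rw [← Finset.prod_sdiff hE, mul_comm]
  congr 1
  · exact Finset.prod_congr rfl fun q hq => by rw [if_neg (Finset.mem_sdiff.1 hq).2]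
  · exact Finset.prod_congr rfl fun q hq => by rw [if_pos hq]

lemma prod_split {n : ℕ} (h : Fin n → Fin n → ℝ) :
    ∏ v, ∏ a ∈ Finset.univ.erase v, h a v =
      (∏ q ∈ upperPairs n, h q.1 q.2) * ∏ q ∈ upperPairs n, h q.2 q.1 := by
  have h1 : ∀ v : Fin n, ∏ a ∈ Finset.univ.erase v, h a v =
      (∏ a, if a < v then h a v else 1) * ∏ a, if v < a then h a v else 1 := by
    intro v
    rw [← Finset.prod_mul_distrib, ← Finset.prod_subset (Finset.erase_subset v Finset.univ)]
    · refine Finset.prod_congr rfl fun a ha => ?_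
      rcases lt_or_gt_of_ne (Finset.ne_of_mem_erase ha) with h | h
      · simp [h, h.le]
      · simp [h, h.le]
    · intro a _ ha
      have : a = v := by simpa using ha
      simp [this]
  simp_rw [h1]
  rw [Finset.prod_mul_distrib]
  congr 1
  · rw [upperPairs, Finset.prod_filter, Finset.prod_comm, ← Finset.univ_product_univ,
      Finset.prod_product]
  · rw [upperPairs, Finset.prod_filter, ← Finset.univ_product_univ,
      Finset.prod_product]

lemma PConn_in {S : Type*} (n : ℕ) (root : Fin n) (x : Fin n → S) (p : S → S → ℝ)
    (hp : ∀ r s, p r s = p s r) :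
    PConn n x p = ∑ N ∈ Fintype.piFinset (fun v : Fin n => (Finset.univ.erase v).powerset),
      (∏ v, wt (fun a b => p (x a) (x b)) v (N v)) * ind (RAll root (fun a b => a ∈ N b)) := by
  rw [PConn_dir n root x p, ← Finset.sum_product']
  have hU : ∀ a b : Fin n, (a, b) ∈ upperPairs n ↔ a < b := by
    intro a b; simp [upperPairs]
  refine Finset.sum_bij'
    (fun EF _ => fun v => Finset.univ.filter (fun a => (a, v) ∈ EF.1 ∨ (v, a) ∈ EF.2))
    (fun N _ => ((upperPairs n).filter (fun q => q.1 ∈ N q.2),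
      (upperPairs n).filter (fun q => q.2 ∈ N q.1))) ?_ ?_ ?_ ?_ ?_
  · rintro ⟨E, F⟩ hEF
    simp only [Finset.mem_product, Finset.mem_powerset] at hEF
    simp only [Fintype.mem_piFinset, Finset.mem_powerset]
    intro v a ha
    simp only [Finset.mem_filter, Finset.mem_univ, true_and] at ha
    simp only [Finset.mem_erase, Finset.mem_univ, and_true]
    rcases ha with ha | ha
    · exact ((hU _ _).1 (hEF.1 ha)).ne
    · exact ((hU _ _).1 (hEF.2 ha)).ne'
  · intro N hN
    simp
  · rintro ⟨E, F⟩ hEF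
    simp only [Finset.mem_product, Finset.mem_powerset] at hEF
    ext ⟨a, b⟩
    · simp only [Finset.mem_filter, Finset.mem_univ, true_and]
      constructor
      · rintro ⟨h1, h2 | h2⟩
        · exact h2
        · exact absurd ((hU _ _).1 (hEF.2 h2)) (lt_asymm ((hU _ _).1 h1))
      · intro h; exact ⟨hEF.1 h, Or.inl h⟩
    · simp only [Finset.mem_filter, Finset.mem_univ, true_and]
      constructor
      · rintro ⟨h1, h2 | h2⟩
        · exact absurd ((hU _ _).1 (hEF.1 h2)) (lt_asymm ((hU _ _).1 h1))
        · exact h2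
      · intro h; exact ⟨hEF.2 h, Or.inr h⟩
  · intro N hN
    simp only [Fintype.mem_piFinset, Finset.mem_powerset] at hN
    funext v
    ext a
    simp only [Finset.mem_filter, Finset.mem_univ, true_and, hU]
    constructor
    · rintro (h | h) <;> exact h.2
    · intro h
      have := Finset.ne_of_mem_erase (hN v h)
      rcases lt_or_gt_of_ne this with h' | h'
      · exact Or.inl ⟨h', h⟩
      · exact Or.inr ⟨h', h⟩
  · rintro ⟨E, F⟩ hEF
    simp only [Finset.mem_product, Finset.mem_powerset] at hEF
    simp only
    congr 1
    · simp only [wt]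
      rw [prod_split (fun a v => if a ∈ Finset.univ.filter (fun a => (a, v) ∈ E ∨ (v, a) ∈ F) then
        p (x a) (x v) else 1 - p (x a) (x v)), prod_ite_sub _ _ hEF.1, prod_ite_sub _ _ hEF.2]
      congr 1
      · refine Finset.prod_congr rfl fun q hq => ?_
        have hq' := (hU q.1 q.2).1 hq
        have : (q.2, q.1) ∉ F := fun h => lt_asymm hq' ((hU _ _).1 (hEF.2 h))
        simp [this]
      · refine Finset.prod_congr rfl fun q hq => ?_
        have hq' := (hU q.1 q.2).1 hq
        have : (q.2, q.1) ∉ E := fun h => lt_asymm hq' ((hU _ _).1 (hEF.1 h))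
        simp [this, hp (x q.2) (x q.1)]
    · simp

lemma sum_wt {V : Type*} [Fintype V] [DecidableEq V] (P : V → V → ℝ) (v : V) :
    ∑ A ∈ (Finset.univ.erase v).powerset, wt P v A = 1 := by
  have : ∀ A ∈ (Finset.univ.erase v).powerset, wt P v A =
      (∏ a ∈ A, P a v) * ∏ a ∈ Finset.univ.erase v \ A, (1 - P a v) := by
    intro A hA
    rw [prod_ite_sub _ _ (Finset.mem_powerset.1 hA)]; rfl
  rw [Finset.sum_congr rfl this, ← Finset.prod_add]
  simp

lemma wt_nonneg {V : Type*} [Fintype V] [DecidableEq V] (P : V → V → ℝ)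
    (h0 : ∀ a b, 0 ≤ P a b) (h1 : ∀ a b, P a b ≤ 1) (v : V) (A : Finset V) : 0 ≤ wt P v A := by
  refine Finset.prod_nonneg fun a _ => ?_
  split_ifs
  · exact h0 _ _
  · exact sub_nonneg.2 (h1 _ _)

lemma PConn_upper {S : Type*} (n : ℕ) (root : Fin n) (x : Fin n → S) (p : S → S → ℝ)
    (hp : ∀ r s, p r s = p s r) (h0 : ∀ r s, 0 ≤ p r s) (h1 : ∀ r s, p r s ≤ 1) :
    PConn n x p ≤ ∏ v ∈ Finset.univ.erase root,
      (1 - ∏ a ∈ Finset.univ.erase v, (1 - p (x a) (x v))) := by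
  rw [PConn_in n root x p hp]
  set P : Fin n → Fin n → ℝ := fun a b => p (x a) (x b) with hP
  let h : Fin n → Finset (Fin n) → ℝ := fun v A => if v = root then 1 else if A = ∅ then 0 else 1
  have hw : ∀ v A, 0 ≤ wt P v A := wt_nonneg P (fun _ _ => h0 _ _) (fun _ _ => h1 _ _)
  calc _ ≤ ∑ N ∈ Fintype.piFinset (fun v : Fin n => (Finset.univ.erase v).powerset),
      ∏ v, (wt P v (N v) * h v (N v)) := by
        refine Finset.sum_le_sum fun N _ => ?_
        rw [Finset.prod_mul_distrib]
        refine mul_le_mul_of_nonneg_left ?_ (Finset.prod_nonneg fun v _ => hw _ _)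
        unfold ind
        split_ifs with hr
        · refine le_of_eq (Finset.prod_eq_one fun v _ => ?_).symm
          by_cases hv : v = root
          · simp [h, hv]
          · have := hr v
            rcases this.cases_tail with h' | ⟨c, _, hc⟩
            · exact absurd h' hv
            · have : N v ≠ ∅ := Finset.ne_empty_of_mem hc
              simp [h, this]
        · refine Finset.prod_nonneg fun v _ => ?_
          simp only [h]; split_ifs <;> norm_num
    _ = ∏ v, ∑ A ∈ (Finset.univ.erase v).powerset, wt P v A * h v A := by
        rw [Finset.prod_univ_sum]
    _ = ∏ v ∈ Finset.univ.erase root, ∑ A ∈ (Finset.univ.erase v).powerset, wt P v A * h v A := by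
        rw [← Finset.mul_prod_erase Finset.univ _ (Finset.mem_univ root)]
        simp [h, sum_wt]
    _ = _ := by
        refine Finset.prod_congr rfl fun v hv => ?_
        have hv' := Finset.ne_of_mem_erase hv
        have : wt P v ∅ = ∏ a ∈ Finset.univ.erase v, (1 - p (x a) (x v)) := by simp [wt, P]
        rw [← this]
        rw [← sum_wt P v, ← Finset.sum_erase_add _ _ (Finset.empty_mem_powerset _),
          ← Finset.sum_erase_add (a := ∅) (f := wt P v) _ (Finset.empty_mem_powerset _)]
        simp only [h, hv', if_false, if_true, mul_zero, add_zero, add_sub_cancel_right]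
        exact Finset.sum_congr rfl fun A hA => by
          rw [if_neg (Finset.ne_of_mem_erase hA), mul_one]

end MC

namespace MC

/-- every vertex flows to the root -/
def Tree {V : Type*} (root : V) (f : V → V) : Prop := ∀ v, ∃ k : ℕ, f^[k] v = root

def treeMat {V : Type*} [DecidableEq V] (root : V) (f : V → V) : Matrix V V ℝ :=
  Matrix.of fun i j => (if i = j then 1 else 0) - (if f i = j ∧ j ≠ root then 1 else 0)

lemma det_treeMat {V : Type*} [Fintype V] [DecidableEq V] (root : V) (f : V → V)
    (hf : f root = root) : (treeMat root f).det = ind (Tree root f) := by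
  unfold ind
  split_ifs with h
  · let d : V → ℕ := fun v => Nat.find (h v)
    have hd : ∀ v, v ≠ root → d (f v) < d v := by
      intro v hv
      have h1 : f^[d v] v = root := Nat.find_spec (h v)
      have h2 : d v ≠ 0 := by
        intro h0; rw [h0] at h1; exact hv h1
      obtain ⟨m, hm⟩ := Nat.exists_eq_succ_of_ne_zero h2
      rw [hm, Function.iterate_succ_apply] at h1
      have : d (f v) ≤ m := Nat.find_min' (h (f v)) h1
      omega
    have hbt : (treeMat root f).BlockTriangular (fun v => OrderDual.toDual (d v)) := by
      intro i j hij
      have hij' : d i < d j := hij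
      have h1 : i ≠ j := by rintro rfl; exact lt_irrefl _ hij'
      have h2 : ¬ (f i = j ∧ j ≠ root) := by
        rintro ⟨rfl, h3⟩
        have hi : i ≠ root := by rintro rfl; exact h3 hf
        exact lt_asymm hij' (hd i hi)
      simp [treeMat, h1, h2]
    rw [hbt.det]
    refine Finset.prod_eq_one fun a _ => ?_
    have : (treeMat root f).toSquareBlock (fun v => OrderDual.toDual (d v)) a = 1 := by
      ext ⟨i, hi⟩ ⟨j, hj⟩
      have hij : d i = d j := by
        have := hi.trans hj.symm
        exact this
      have h2 : ¬ (f i = j ∧ j ≠ root) := by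
        rintro ⟨rfl, h3⟩
        have hi : i ≠ root := by rintro rfl; exact h3 hf
        have := hd i hi
        omega
      simp [Matrix.toSquareBlock_def, treeMat, h2, Matrix.one_apply]
    rw [this, Matrix.det_one]
  · unfold Tree at h
    push Not at h
    obtain ⟨v, hv⟩ := h
    rw [← Matrix.exists_mulVec_eq_zero_iff]
    refine ⟨fun u => if ∀ k : ℕ, f^[k] u ≠ root then 1 else 0, ?_, ?_⟩
    · intro h0
      have := congrFun h0 v
      simp [hv] at this
    · funext i
      simp only [Matrix.mulVec, dotProduct, treeMat, Matrix.of_apply, sub_mul, ite_mul, one_mul,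
        zero_mul, Finset.sum_sub_distrib, Finset.sum_ite_eq, Finset.mem_univ, if_true,
        Pi.zero_apply]
      rw [Finset.sum_eq_single (f i)]
      · by_cases hi : ∀ k : ℕ, f^[k] i ≠ root
        · have h1 : ∀ k : ℕ, f^[k] (f i) ≠ root := fun k => by
            rw [← Function.iterate_succ_apply]; exact hi _
          have h2 : f i ≠ root := h1 0
          simp [hi, h1, h2]
        · have h1 : ¬ ∀ k : ℕ, f^[k] (f i) ≠ root := by
            push Not at hi ⊢
            obtain ⟨k, hk⟩ := hi
            refine ⟨k, ?_⟩
            rw [← Function.iterate_succ_apply, Function.iterate_succ_apply', hk, hf]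
          rw [if_neg hi, if_neg h1]; simp
      · intro j _ hj
        rw [if_neg]; rintro ⟨h, _⟩; exact hj h.symm
      · simp

def lapMat {V : Type*} [Fintype V] [DecidableEq V] (root : V) (w : V → V → ℝ) : Matrix V V ℝ :=
  Matrix.of fun i j => (if i = j then ∑ a, w i a else 0) - (if j ≠ root then w i j else 0)

lemma matrix_tree {V : Type*} [Fintype V] [DecidableEq V] (root : V) (w : V → V → ℝ)
    (hw : ∀ a, a ≠ root → w root a = 0) :
    (lapMat root w).det = ∑ f : V → V, (∏ i, w i (f i)) * ind (Tree root f) := by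
  have h1 : lapMat root w = fun i => ∑ a, w i a • (fun j =>
      (if i = j then (1:ℝ) else 0) - (if a = j ∧ j ≠ root then 1 else 0)) := by
    funext i j
    rw [Finset.sum_apply]
    simp only [lapMat, Matrix.of_apply, Pi.smul_apply, smul_eq_mul, mul_sub,
      Finset.sum_sub_distrib]
    congr 1
    · split_ifs <;> simp
    · by_cases hj : j = root <;> simp [hj]
  have h2 := (Matrix.detRowAlternating (n := V) (R := ℝ)).toMultilinearMap.map_sum
    (fun i a => w i a • (fun j =>
      (if i = j then (1:ℝ) else 0) - (if a = j ∧ j ≠ root then 1 else 0)))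
  rw [← h1] at h2
  have h3 : (lapMat root w).det = Matrix.detRowAlternating.toMultilinearMap (lapMat root w) := rfl
  rw [h3, h2]
  refine Finset.sum_congr rfl fun f _ => ?_
  rw [MultilinearMap.map_smul_univ, smul_eq_mul]
  by_cases hf : f root = root
  · rw [← det_treeMat root f hf]; rfl
  · have : ∏ i, w i (f i) = 0 := Finset.prod_eq_zero (Finset.mem_univ root) (hw _ hf)
    simp [this]

lemma matrix_tree_ge {V : Type*} [Fintype V] [DecidableEq V] (root : V) (w : V → V → ℝ)
    (hw : ∀ a, a ≠ root → w root a = 0) (hw0 : ∀ a b, 0 ≤ w a b) (g : V → V)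
    (hg : Tree root g) : ∏ i, w i (g i) ≤ (lapMat root w).det := by
  rw [matrix_tree root w hw]
  have : ∏ i, w i (g i) = (∏ i, w i (g i)) * ind (Tree root g) := by simp [ind, hg]
  rw [this]
  refine Finset.single_le_sum (f := fun f : V → V => (∏ i, w i (f i)) * ind (Tree root f))
    (fun f _ => ?_) (Finset.mem_univ g)
  refine mul_nonneg (Finset.prod_nonneg fun _ _ => hw0 _ _) ?_
  unfold ind; split_ifs <;> norm_num

lemma PConn_lower {S : Type*} (n : ℕ) (root : Fin n) (x : Fin n → S) (p : S → S → ℝ)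
    (hp : ∀ r s, p r s = p s r) (h0 : ∀ r s, 0 ≤ p r s) (h1 : ∀ r s, p r s ≤ 1)
    (G : Fin n → ℝ) (hG0 : ∀ v, 0 ≤ G v)
    (hG : ∀ v a, v ≠ root → a ≠ v → p (x v) (x a) * G v ≤
      ∑ A ∈ (Finset.univ.erase v).powerset, wt (fun a b => p (x a) (x b)) v A *
        (if a ∈ A then 1 / (A.card : ℝ) else 0)) :
    (∏ v ∈ Finset.univ.erase root, G v) * (lapMat root (fun v a => if v = root then
      (if a = root then 1 else 0) else if a = v then 0 else p (x v) (x a))).det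
      ≤ PConn n x p := by
  rw [PConn_in n root x p hp, matrix_tree _ _ (by intro a ha; simp [ha])]
  set P : Fin n → Fin n → ℝ := fun a b => p (x a) (x b) with hP
  have hw : ∀ v A, 0 ≤ wt P v A := wt_nonneg P (fun _ _ => h0 _ _) (fun _ _ => h1 _ _)
  set w : Fin n → Fin n → ℝ := fun v a => if v = root then
      (if a = root then 1 else 0) else if a = v then 0 else p (x v) (x a) with hwdef
  have hw0 : ∀ v a, 0 ≤ w v a := by
    intro v a; simp only [w]; split_ifs <;> first | exact h0 _ _ | norm_num
  let c : Fin n → Fin n → Finset (Fin n) → ℝ := fun v a A =>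
    if v = root then (if a = root then 1 else 0) else if a ∈ A then 1 / (A.card : ℝ) else 0
  have hc0 : ∀ v a A, 0 ≤ c v a A := by
    intro v a A; simp only [c]; split_ifs <;> positivity
  have hcs : ∀ v A, ∑ a, c v a A ≤ 1 := by
    intro v A
    by_cases hv : v = root
    · simp [c, hv]
    · simp only [c, hv, if_false]
      rw [Finset.sum_ite_mem, Finset.univ_inter, Finset.sum_const, nsmul_eq_mul]
      by_cases hA : (A.card : ℝ) = 0
      · simp [hA]
      · rw [mul_one_div_cancel hA]
  have hstep : ∀ N : Fin n → Finset (Fin n),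
      ∑ f : Fin n → Fin n, ind (Tree root f) * ∏ v, c v (f v) (N v) ≤
        ind (RAll root (fun a b => a ∈ N b)) := by
    intro N
    by_cases hr : RAll root (fun a b => a ∈ N b)
    · simp only [ind, hr, if_true]
      calc _ ≤ ∑ f : Fin n → Fin n, ∏ v, c v (f v) (N v) := by
            refine Finset.sum_le_sum fun f _ => ?_
            have := Finset.prod_nonneg (s := Finset.univ) fun v _ => hc0 v (f v) (N v)
            split_ifs
            · simp
            · simpa using this
        _ = ∏ v, ∑ a, c v a (N v) := by rw [Finset.prod_univ_sum]; simp
        _ ≤ 1 := Finset.prod_le_one (fun v _ => Finset.sum_nonneg fun a _ => hc0 _ _ _)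
            fun v _ => hcs _ _
    · simp only [ind, hr, if_false]
      refine le_of_eq (Finset.sum_eq_zero fun f _ => ?_)
      split_ifs with ht
      · rw [one_mul]
        by_contra hne
        rw [← ne_eq, Finset.prod_ne_zero_iff] at hne
        apply hr
        have hmem : ∀ v, v ≠ root → f v ∈ N v := by
          intro v hv
          have := hne v (Finset.mem_univ v)
          simp only [c, hv, if_false] at this
          by_contra h; exact this (if_neg h)
        have : ∀ k : ℕ, ∀ v, f^[k] v = root →
            Relation.ReflTransGen (fun a b => a ∈ N b) root v := by
          intro k
          induction k with
          | zero => intro v hv; simp at hv; subst hv; exact .refl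
          | succ k ih =>
            intro v hv
            by_cases hvr : v = root
            · subst hvr; exact .refl
            · exact (ih (f v) (by rwa [Function.iterate_succ_apply] at hv)).tail (hmem v hvr)
        intro v
        obtain ⟨k, hk⟩ := ht v
        exact this k v hk
      · simp
  calc _ = ∑ f : Fin n → Fin n, ind (Tree root f) *
        ∏ v, ((if v = root then 1 else G v) * w v (f v)) := by
        rw [Finset.mul_sum]
        refine Finset.sum_congr rfl fun f _ => ?_
        rw [Finset.prod_mul_distrib, ← Finset.mul_prod_erase Finset.univ
          (fun v => if v = root then 1 else G v) (Finset.mem_univ root)]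
        have : ∏ v ∈ Finset.univ.erase root, (if v = root then 1 else G v) =
            ∏ v ∈ Finset.univ.erase root, G v :=
          Finset.prod_congr rfl fun v hv => if_neg (Finset.ne_of_mem_erase hv)
        rw [this]; simp; ring
    _ ≤ ∑ f : Fin n → Fin n, ind (Tree root f) *
        ∏ v, ∑ A ∈ (Finset.univ.erase v).powerset, wt P v A * c v (f v) A := by
        refine Finset.sum_le_sum fun f _ => ?_
        refine mul_le_mul_of_nonneg_left ?_ (by unfold ind; split_ifs <;> norm_num)
        refine Finset.prod_le_prod (fun v _ => ?_) (fun v _ => ?_)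
        · refine mul_nonneg ?_ (hw0 _ _)
          split_ifs
          · norm_num
          · exact hG0 v
        · by_cases hv : v = root
          · simp only [hv, if_true, w, c]
            rw [← Finset.sum_mul, sum_wt]
          · by_cases hfv : f v = v
            · have : w v (f v) = 0 := by simp [w, hv, hfv]
              rw [this, mul_zero]
              exact Finset.sum_nonneg fun A _ => mul_nonneg (hw _ _) (hc0 _ _ _)
            · have := hG v (f v) hv hfv
              simp only [hv, if_false, w, c, hfv]
              linarith
    _ = ∑ N ∈ Fintype.piFinset (fun v : Fin n => (Finset.univ.erase v).powerset),
        (∏ v, wt P v (N v)) * ∑ f : Fin n → Fin n, ind (Tree root f) * ∏ v, c v (f v) (N v) := by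
        simp_rw [Finset.prod_univ_sum, Finset.mul_sum]
        rw [Finset.sum_comm]
        refine Finset.sum_congr rfl fun N _ => Finset.sum_congr rfl fun f _ => ?_
        rw [Finset.prod_mul_distrib]; ring
    _ ≤ _ := Finset.sum_le_sum fun N _ => mul_le_mul_of_nonneg_left (hstep N)
        (Finset.prod_nonneg fun v _ => hw _ _)

end MC

namespace MC

lemma one_sub_ge_exp {ε s : ℝ} (hε : ε < 1) (h0 : 0 ≤ s) (h1 : s ≤ ε) :
    Real.exp (-(s / (1 - ε))) ≤ 1 - s := by
  have hs : 0 < 1 - s := by linarith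
  have h2 : s / (1 - s) ≤ s / (1 - ε) := div_le_div_of_nonneg_left h0 (by linarith) (by linarith)
  have h3 := Real.add_one_le_exp (s / (1 - s))
  have h4 : s / (1 - s) + 1 = (1 - s)⁻¹ := by field_simp; ring
  rw [h4] at h3
  have h5 := h3.trans (Real.exp_le_exp.2 h2)
  rw [Real.exp_neg]
  exact inv_le_of_inv_le₀ hs h5

lemma prod_ge_exp {α : Type*} (Z : Finset α) (q : α → ℝ) {ε : ℝ} (hε : ε < 1)
    (h0 : ∀ b, 0 ≤ q b) (h1 : ∀ b, q b ≤ ε) :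
    Real.exp (-((∑ b ∈ Z, q b) / (1 - ε))) ≤ ∏ b ∈ Z, (1 - q b) := by
  rw [Finset.sum_div, ← Finset.sum_neg_distrib, Real.exp_sum]
  exact Finset.prod_le_prod (fun b _ => (Real.exp_pos _).le)
    fun b _ => one_sub_ge_exp hε (h0 b) (h1 b)

lemma harm_ge {α : Type*} [DecidableEq α] (Z : Finset α) (q : α → ℝ) {ε D : ℝ} (hε : ε < 1)
    (hε0 : 0 ≤ ε)
    (h0 : ∀ b, 0 ≤ q b) (h1 : ∀ b, q b ≤ ε) (hD : 0 < D) (hZ : ∑ b ∈ Z, q b ≤ D) :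
    (1 - ε) * (1 - Real.exp (-D)) / D ≤
      ∑ B ∈ Z.powerset, ((∏ b ∈ B, q b) * ∏ b ∈ Z \ B, (1 - q b)) * (1 / ((B.card : ℝ) + 1)) := by
  have e1 : ∑ B ∈ Z.powerset, ((∏ b ∈ B, q b) * ∏ b ∈ Z \ B, (1 - q b)) * (1 / ((B.card : ℝ) + 1))
      = ∫ t in (0:ℝ)..1, ∏ b ∈ Z, (q b * t + (1 - q b)) := by
    have : ∀ t : ℝ, ∏ b ∈ Z, (q b * t + (1 - q b)) =
        ∑ B ∈ Z.powerset, ((∏ b ∈ B, q b) * ∏ b ∈ Z \ B, (1 - q b)) * t ^ B.card := by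
      intro t
      rw [Finset.prod_add]
      refine Finset.sum_congr rfl fun B _ => ?_
      rw [Finset.prod_mul_distrib, Finset.prod_const]; ring
    simp_rw [this]
    rw [intervalIntegral.integral_finsetSum]
    · refine Finset.sum_congr rfl fun B _ => ?_
      rw [intervalIntegral.integral_const_mul, integral_pow]
      simp
    · intro B _
      exact (Continuous.intervalIntegrable (by fun_prop) _ _)
  rw [e1]
  set c : ℝ := D / (1 - ε) with hc
  have h1ε : 0 < 1 - ε := by linarith
  have hcpos : 0 < c := div_pos hD h1ε
  have e2 : ∫ t in (0:ℝ)..1, Real.exp (-(c * (1 - t))) = (1 - Real.exp (-c)) / c := by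
    have : ∀ t ∈ Set.uIcc (0:ℝ) 1, HasDerivAt (fun t => Real.exp (-(c * (1 - t))) / c)
        (Real.exp (-(c * (1 - t)))) t := by
      intro t _
      have h := (((((hasDerivAt_id t).const_sub 1).const_mul c).neg).exp).div_const c
      refine h.congr_deriv ?_
      simp only [id_eq]
      field_simp
      rfl
    rw [intervalIntegral.integral_eq_sub_of_hasDerivAt this
      (Continuous.intervalIntegrable (by fun_prop) _ _)]
    simp; ring
  calc (1 - ε) * (1 - Real.exp (-D)) / D = (1 - Real.exp (-D)) / c := by
        rw [hc]; field_simp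
    _ ≤ (1 - Real.exp (-c)) / c := by
        have : D ≤ c := by
          rw [hc, le_div_iff₀ h1ε]; nlinarith
        have : Real.exp (-c) ≤ Real.exp (-D) := Real.exp_le_exp.2 (by linarith)
        gcongr
    _ = ∫ t in (0:ℝ)..1, Real.exp (-(c * (1 - t))) := e2.symm
    _ ≤ _ := by
        refine intervalIntegral.integral_mono_on (by norm_num)
          (Continuous.intervalIntegrable (by fun_prop) _ _)
          (Continuous.intervalIntegrable (by fun_prop) _ _) ?_
        intro t ht
        have ht1 : 0 ≤ 1 - t := by linarith [ht.2]
        have := prod_ge_exp Z (fun b => q b * (1 - t)) hε (fun b => mul_nonneg (h0 b) ht1)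
          (fun b => by nlinarith [h0 b, h1 b, ht.1])
        refine le_trans (Real.exp_le_exp.2 ?_) (this.trans_eq
          (Finset.prod_congr rfl fun b _ => by ring))
        rw [← Finset.sum_mul, hc, neg_le_neg_iff, mul_div_right_comm]
        gcongr

lemma hG_lemma {V : Type*} [Fintype V] [DecidableEq V] (P : V → V → ℝ) {ε D : ℝ} (hε : ε < 1)
    (hε0 : 0 ≤ ε) (h0 : ∀ a b, 0 ≤ P a b) (h1 : ∀ a b, P a b ≤ ε) (v a : V) (hav : a ≠ v)
    (hD : 0 < D) (hZ : ∑ b, P b v ≤ D) :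
    P a v * ((1 - ε) * (1 - Real.exp (-D)) / D) ≤
    ∑ A ∈ (Finset.univ.erase v).powerset, wt P v A *
        (if a ∈ A then 1 / (A.card : ℝ) else 0) := by
  set Z := (Finset.univ.erase v).erase a with hZdef
  have haZ : a ∉ Z := Finset.notMem_erase _ _
  have hins : Finset.univ.erase v = insert a Z := by
    rw [hZdef, Finset.insert_erase]; simp [hav]
  have hle : ∑ b ∈ Z, P b v ≤ D := le_trans
    (Finset.sum_le_sum_of_subset_of_nonneg (Finset.subset_univ _) fun b _ _ => h0 _ _) hZ
  have := harm_ge Z (fun b => P b v) hε hε0 (fun b => h0 _ _) (fun b => h1 _ _) hD hle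
  refine (mul_le_mul_of_nonneg_left this (h0 a v)).trans ?_
  simp only [wt]
  rw [hins, Finset.sum_powerset_insert haZ, Finset.mul_sum]
  have hz : ∑ B ∈ Z.powerset, (∏ b ∈ insert a Z, if b ∈ B then P b v else 1 - P b v) *
      (if a ∈ B then 1 / (B.card : ℝ) else 0) = 0 := by
    refine Finset.sum_eq_zero fun B hB => ?_
    have haB : a ∉ B := fun h => haZ (Finset.mem_powerset.1 hB h)
    simp [haB]
  rw [hz, zero_add]
  · refine Finset.sum_le_sum fun B hB => le_of_eq ?_
    have hB' := Finset.mem_powerset.1 hB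
    have haB : a ∉ B := fun h => haZ (hB' h)
    rw [prod_ite_sub _ _ hB', Finset.prod_insert haZ, Finset.card_insert_of_notMem haB]
    have : ∏ b ∈ Z, (if b ∈ insert a B then P b v else 1 - P b v) =
        ∏ b ∈ Z, (if b ∈ B then P b v else 1 - P b v) := by
      refine Finset.prod_congr rfl fun b hb => ?_
      have : b ≠ a := fun h => haZ (h ▸ hb)
      simp [this]
    rw [this]; simp; ring

def Re {V : Type*} (root : V) (R : V → V → Prop) : ℕ → V → Prop
  | 0, v => v = root
  | k + 1, v => ∃ u, R v u ∧ Re root R k u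

lemma exists_tree {V : Type*} (root : V) (R : V → V → Prop)
    (h : ∀ v, Relation.ReflTransGen R v root) :
    ∃ g : V → V, Tree root g ∧ g root = root ∧ ∀ v, v ≠ root → R v (g v) := by
  have hRe : ∀ v, ∃ k, Re root R k v := by
    intro v
    induction h v using Relation.ReflTransGen.head_induction_on with
    | refl => exact ⟨0, rfl⟩
    | head hab _ ih => obtain ⟨k, hk⟩ := ih; exact ⟨k + 1, _, hab, hk⟩
  let d : V → ℕ := fun v => Nat.find (hRe v)
  have hd : ∀ v, ∃ u, (v = root → u = root) ∧ (v ≠ root → R v u ∧ d u < d v) := by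
    intro v
    by_cases hv : v = root
    · exact ⟨root, fun _ => rfl, fun h => absurd hv h⟩
    · have h1 : Re root R (d v) v := Nat.find_spec (hRe v)
      have h2 : d v ≠ 0 := by
        intro h0; rw [h0] at h1; exact hv h1
      obtain ⟨m, hm⟩ := Nat.exists_eq_succ_of_ne_zero h2
      rw [hm] at h1
      obtain ⟨u, hu, hu2⟩ := h1
      refine ⟨u, fun h => absurd h hv, fun _ => ⟨hu, ?_⟩⟩
      have : d u ≤ m := Nat.find_min' (hRe u) hu2
      omega
  choose g hg1 hg2 using hd
  refine ⟨g, ?_, hg1 root rfl, fun v hv => (hg2 v hv).1⟩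
  have : ∀ m v, d v ≤ m → ∃ k : ℕ, g^[k] v = root := by
    intro m
    induction m with
    | zero =>
      intro v hv
      by_cases hvr : v = root
      · exact ⟨0, hvr⟩
      · have := (hg2 v hvr).2; omega
    | succ m ih =>
      intro v hv
      by_cases hvr : v = root
      · exact ⟨0, hvr⟩
      · have := (hg2 v hvr).2
        obtain ⟨k, hk⟩ := ih (g v) (by omega)
        exact ⟨k + 1, by rw [Function.iterate_succ_apply]; exact hk⟩
  exact fun v => this _ v le_rfl

end MC

namespace MC

section types
set_option linter.unusedSectionVars false
variable {S : Type*} [Fintype S] [DecidableEq S]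

/-- number of non-root vertices of type `s` -/
def kk {n : ℕ} (root : Fin n) (x : Fin n → S) (s : S) : ℝ :=
  ∑ a ∈ Finset.univ.erase root, if x a = s then 1 else 0

def Dd {n : ℕ} (x : Fin n → S) (p : S → S → ℝ) (r : S) : ℝ := ∑ a, p r (x a)

def WW {n : ℕ} (root : Fin n) (x : Fin n → S) (p : S → S → ℝ) : Option S → Option S → ℝ
  | none, none => 1
  | none, some _ => 0
  | some r, none => if kk root x r = 0 then 1 else p r (x root)
  | some r, some s => if kk root x r = 0 then 0 else p r s * kk root x s

lemma kk_ne {n : ℕ} (root : Fin n) (x : Fin n → S) (v : Fin n) (hv : v ≠ root) :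
    1 ≤ kk root x (x v) := by
  unfold kk
  have := Finset.single_le_sum (f := fun a => if x a = x v then (1:ℝ) else 0)
    (s := Finset.univ.erase root) (fun a _ => by split_ifs <;> norm_num)
    (Finset.mem_erase.2 ⟨hv, Finset.mem_univ v⟩)
  simpa using this

lemma Dd_eq {n : ℕ} (root : Fin n) (x : Fin n → S) (p : S → S → ℝ) (r : S) :
    Dd x p r = p r (x root) + ∑ s, p r s * kk root x s := by
  unfold Dd kk
  rw [← Finset.add_sum_erase _ _ (Finset.mem_univ root)]
  congr 1
  simp_rw [Finset.mul_sum]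
  rw [Finset.sum_comm]
  refine Finset.sum_congr rfl fun a _ => ?_
  simp

lemma WW_sum {n : ℕ} (root : Fin n) (x : Fin n → S) (p : S → S → ℝ) (r : S) :
    ∑ u, WW root x p (some r) u = if kk root x r = 0 then 1 else Dd x p r := by
  rw [Fintype.sum_option]
  by_cases h : kk root x r = 0
  · simp [WW, h]
  · simp [WW, h, Dd_eq root x p r]

lemma WW_sum_none {n : ℕ} (root : Fin n) (x : Fin n → S) (p : S → S → ℝ) :
    ∑ u, WW root x p none u = 1 := by
  rw [Fintype.sum_option]
  simp [WW]

lemma det_reduce {n : ℕ} (root : Fin n) (x : Fin n → S) (p : S → S → ℝ)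
    (hD : ∀ v, v ≠ root → Dd x p (x v) ≠ 0) :
    (lapMat root (fun v a => if v = root then
      (if a = root then 1 else 0) else if a = v then 0 else p (x v) (x a))).det *
      ∏ t, ∑ u, WW root x p t u =
    (∏ v ∈ Finset.univ.erase root, Dd x p (x v)) * (lapMat none (WW root x p)).det := by
  let e : Fin n → ℝ := fun i => if i = root then 1 else Dd x p (x i)
  let d : Option S → ℝ := fun t => ∑ u, WW root x p t u
  let Y : Matrix (Fin n) (Option S) ℝ := Matrix.of fun i t => if i ≠ root ∧ t = some (x i) then 1 else 0
  let K : Matrix (Option S) (Option S) ℝ := Matrix.of fun t u => match t, u with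
    | some r, some s => if kk root x r = 0 then 0 else p r s
    | _, _ => 0
  let k' : Option S → ℝ := fun t => match t with
    | none => 0
    | some s => kk root x s
  have he : ∀ i, e i ≠ 0 := by
    intro i; simp only [e]; split_ifs with h
    · norm_num
    · exact hD i h
  have hd : ∀ t, d t ≠ 0 := by
    intro t
    cases t with
    | none => simp only [d]; rw [WW_sum_none]; norm_num
    | some r =>
      simp only [d, WW_sum]
      split_ifs with h
      · norm_num
      · have : ∃ v, v ≠ root ∧ x v = r := by
          by_contra hne
          push Not at hne
          apply h
          unfold kk
          refine Finset.sum_eq_zero fun a ha => ?_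
          simp [hne a (Finset.ne_of_mem_erase ha)]
        obtain ⟨v, hv, rfl⟩ := this
        exact hD v hv
  have hYK : ∀ i j, (Y * K * Y.transpose) i j =
      if i ≠ root ∧ j ≠ root then p (x i) (x j) else 0 := by
    intro i j
    simp only [Matrix.mul_apply, Matrix.transpose_apply]
    by_cases hi : i = root
    · simp [Y, hi]
    by_cases hj : j = root
    · simp [Y, hj]
    have : kk root x (x i) ≠ 0 := by have := kk_ne root x i hi; linarith
    simp [Y, K, hi, hj, this]
  have hM1 : lapMat root (fun v a => if v = root then
      (if a = root then 1 else 0) else if a = v then 0 else p (x v) (x a)) =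
      Matrix.diagonal e - Y * K * Y.transpose := by
    ext i j
    rw [Matrix.sub_apply, hYK, Matrix.diagonal_apply]
    simp only [lapMat, Matrix.of_apply, e]
    by_cases hi : i = root
    · subst hi
      by_cases hj : j = i
      · simp [hj]
      · simp [hj]
    · simp only [hi, if_false]
      have hs : ∑ a, (if a = i then 0 else p (x i) (x a)) = Dd x p (x i) - p (x i) (x i) := by
        unfold Dd
        rw [← Finset.add_sum_erase _ _ (Finset.mem_univ i),
          ← Finset.add_sum_erase _ (fun a => p (x i) (x a)) (Finset.mem_univ i)]
        rw [if_pos rfl, zero_add, add_sub_cancel_left]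
        exact Finset.sum_congr rfl fun a ha => if_neg (Finset.ne_of_mem_erase ha)
      rw [hs]
      by_cases hj : j = i
      · subst hj; simp [hi]
      · by_cases hjr : j = root
        · simp [hjr, hi]
        · simp [hjr, hi, hj, Ne.symm hj]
  have hz : Y.transpose * Matrix.diagonal (fun i => (e i)⁻¹) * Y =
      Matrix.diagonal (fun t => k' t / d t) := by
    ext t u
    rw [Matrix.mul_apply, Matrix.diagonal_apply]
    simp only [Matrix.mul_diagonal, Matrix.transpose_apply]
    cases t with
    | none => simp [Y, k']
    | some r =>
      by_cases hu : some r = u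
      · subst hu
        rw [if_pos rfl]
        simp only [k', d, WW_sum]
        by_cases hr : kk root x r = 0
        · have : ∀ v, v ≠ root → x v ≠ r := by
            rintro v hv rfl
            have := kk_ne root x v hv; linarith
          rw [hr, zero_div]
          refine Finset.sum_eq_zero fun i _ => ?_
          by_cases hi : i = root
          · simp [Y, hi]
          · simp [Y, hi, Ne.symm (this i hi)]
        · rw [if_neg hr]
          conv_rhs => unfold kk
          rw [Finset.sum_div, ← Finset.add_sum_erase _ _ (Finset.mem_univ root)]
          have : Y root (some r) = 0 := by simp [Y]
          rw [this, mul_zero, zero_add]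
          refine Finset.sum_congr rfl fun i hi => ?_
          have hi' := Finset.ne_of_mem_erase hi
          by_cases hx : x i = r
          · subst hx; simp [Y, hi', e]
          · simp [Y, hi', hx, Ne.symm hx]
      · rw [if_neg hu]
        refine Finset.sum_eq_zero fun i _ => ?_
        simp only [Y, Matrix.of_apply]
        by_cases hi : i ≠ root ∧ some r = some (x i)
        · have : ¬ (i ≠ root ∧ u = some (x i)) := by
            rintro ⟨_, h⟩; exact hu (hi.2.trans h.symm)
          simp [this]
        · rw [if_neg hi]; simp
  have hM2 : lapMat none (WW root x p) = Matrix.diagonal d - K * Matrix.diagonal k' := by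
    ext t u
    rw [Matrix.sub_apply, Matrix.mul_diagonal, Matrix.diagonal_apply]
    simp only [lapMat, Matrix.of_apply]
    congr 1
    cases t with
    | none => cases u <;> simp [WW, K]
    | some r =>
      cases u with
      | none => simp [k']
      | some s => simp [WW, K, k']
  have h1 : (Matrix.diagonal e - Y * K * Y.transpose) =
      Matrix.diagonal e * (1 - (Matrix.diagonal (fun i => (e i)⁻¹) * Y) * (K * Y.transpose)) := by
    rw [mul_sub, mul_one]
    congr 1
    rw [← Matrix.mul_assoc, ← Matrix.mul_assoc, ← Matrix.mul_assoc, Matrix.diagonal_mul_diagonal]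
    have : (fun i => e i * (e i)⁻¹) = fun _ => 1 := funext fun i => mul_inv_cancel₀ (he i)
    rw [this, Matrix.diagonal_one, Matrix.one_mul]
  have h2 : Matrix.diagonal d - K * Matrix.diagonal k' =
      (1 - K * Matrix.diagonal (fun t => k' t / d t)) * Matrix.diagonal d := by
    rw [sub_mul, one_mul, Matrix.mul_assoc, Matrix.diagonal_mul_diagonal]
    have : (fun t => k' t / d t * d t) = k' := funext fun t => div_mul_cancel₀ _ (hd t)
    rw [this]
  rw [hM1, hM2, h1, h2, Matrix.det_mul, Matrix.det_mul, Matrix.det_one_sub_mul_comm,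
    Matrix.mul_assoc K, ← Matrix.mul_assoc Y.transpose, hz, Matrix.det_diagonal, Matrix.det_diagonal]
  have : ∏ i, e i = ∏ v ∈ Finset.univ.erase root, Dd x p (x v) := by
    rw [← Finset.mul_prod_erase _ _ (Finset.mem_univ root)]
    simp only [e, if_true, one_mul]
    exact Finset.prod_congr rfl fun v hv => if_neg (Finset.ne_of_mem_erase hv)
  rw [this]; ring

end types

end MC

namespace MC

section fin
set_option linter.unusedSectionVars false
variable {S : Type*} [Fintype S] [DecidableEq S]

lemma WW_nonneg {n : ℕ} (root : Fin n) (x : Fin n → S) (p : S → S → ℝ)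
    (h0 : ∀ r s, 0 ≤ p r s) (t u : Option S) : 0 ≤ WW root x p t u := by
  have hk : ∀ s, 0 ≤ kk root x s := fun s =>
    Finset.sum_nonneg fun a _ => by split_ifs <;> norm_num
  cases t <;> cases u <;> simp only [WW]
  · norm_num
  · norm_num
  · split_ifs
    · norm_num
    · exact h0 _ _
  · split_ifs
    · norm_num
    · exact mul_nonneg (h0 _ _) (hk _)

lemma Dd_ge {n : ℕ} (root : Fin n) (x : Fin n → S) (p : S → S → ℝ)
    (hp : ∀ r s, p r s = p s r) (h0 : ∀ r s, 0 ≤ p r s) {m : ℝ}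
    (hadj : RAll root (fun a b => m ≤ p (x a) (x b))) (v : Fin n) (hv : v ≠ root) :
    m ≤ Dd x p (x v) := by
  rcases (hadj v).cases_tail with h | ⟨c, _, hc⟩
  · exact absurd h hv
  · rw [hp] at hc
    exact hc.trans (Finset.single_le_sum (f := fun a => p (x v) (x a)) (fun a _ => h0 _ _)
      (Finset.mem_univ c))

lemma ratio_ge {n : ℕ} (root : Fin n) (x : Fin n → S) (p : S → S → ℝ)
    (hp : ∀ r s, p r s = p s r) (h0 : ∀ r s, 0 ≤ p r s) {m M : ℝ}
    (hm : 0 < m) (hm1 : m ≤ 1) (hadj : RAll root (fun a b => m ≤ p (x a) (x b)))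
    (hM : ∀ r, Dd x p r ≤ M) (hM1 : 1 ≤ M) :
    (m / M) ^ Fintype.card S * ∏ t, ∑ u, WW root x p t u ≤ (lapMat none (WW root x p)).det := by
  have hpath : ∀ t : Option S, Relation.ReflTransGen (fun t u => m ≤ WW root x p t u) t none := by
    have hv : ∀ v, Relation.ReflTransGen (fun t u => m ≤ WW root x p t u)
        (if v = root then none else some (x v)) none := by
      intro v
      induction hadj v with
      | refl => simp; exact .refl
      | @tail a b _ hab ih =>
        by_cases hb : b = root
        · simp [hb]; exact .refl
        · refine Relation.ReflTransGen.head ?_ ih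
          have hkb : kk root x (x b) ≠ 0 := by have := kk_ne root x b hb; linarith
          by_cases ha : a = root
          · simp only [hb, ha, if_true, if_false, WW, hkb]
            rw [hp, ← ha]; exact hab
          · simp only [hb, ha, if_false, WW, hkb]
            have := kk_ne root x a ha
            rw [hp] at hab
            nlinarith
    intro t
    cases t with
    | none => exact .refl
    | some r =>
      by_cases hr : kk root x r = 0
      · refine Relation.ReflTransGen.single ?_
        simp [WW, hr, hm1]
      · have : ∃ v, v ≠ root ∧ x v = r := by
          by_contra hne
          push Not at hne
          apply hr
          unfold kk
          refine Finset.sum_eq_zero fun a ha => ?_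
          simp [hne a (Finset.ne_of_mem_erase ha)]
        obtain ⟨v, hvr, rfl⟩ := this
        have := hv v
        rwa [if_neg hvr] at this
  obtain ⟨g, hg, hgr, hgW⟩ := exists_tree none _ hpath
  refine le_trans ?_ (matrix_tree_ge none (WW root x p) ?_ (WW_nonneg root x p h0) g hg)
  · rw [Fintype.prod_option, Fintype.prod_option, hgr, WW_sum_none]
    have e1 : WW root x p none none = 1 := rfl
    rw [e1, one_mul, one_mul, ← Finset.card_univ, ← Finset.prod_const, ← Finset.prod_mul_distrib]
    have hMpos : 0 < M := by linarith
    refine Finset.prod_le_prod (fun r _ => ?_) (fun r _ => ?_)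
    · exact mul_nonneg (by positivity) (Finset.sum_nonneg fun u _ => WW_nonneg root x p h0 _ _)
    · have h1 : m ≤ WW root x p (some r) (g (some r)) := hgW (some r) (by simp)
      refine le_trans ?_ h1
      have h2 : ∑ u, WW root x p (some r) u ≤ M := by
        rw [WW_sum]; split_ifs
        · exact hM1
        · exact hM r
      calc m / M * ∑ u, WW root x p (some r) u ≤ m / M * M := by gcongr
        _ = m := by field_simp
  · intro a ha
    cases a with
    | none => exact absurd rfl ha
    | some s => rfl

lemma lower_fin {n : ℕ} (root : Fin n) (x : Fin n → S) (p : S → S → ℝ)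
    (hp : ∀ r s, p r s = p s r) (h0 : ∀ r s, 0 ≤ p r s) {m M ε : ℝ} (hε0 : 0 ≤ ε) (hε : ε < 1)
    (h1 : ∀ r s, p r s ≤ ε)
    (hm : 0 < m) (hm1 : m ≤ 1) (hadj : RAll root (fun a b => m ≤ p (x a) (x b)))
    (hM : ∀ r, Dd x p r ≤ M) (hM1 : 1 ≤ M) :
    (m / M) ^ Fintype.card S * (1 - ε) ^ n * ∏ v, (1 - Real.exp (-Dd x p (x v)))
      ≤ PConn n x p := by
  have hDv : ∀ v, v ≠ root → 0 < Dd x p (x v) := fun v hv =>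
    hm.trans_le (Dd_ge root x p hp h0 hadj v hv)
  have hD0 : ∀ r, 0 ≤ Dd x p r := fun r => Finset.sum_nonneg fun a _ => h0 _ _
  have hF0 : ∀ r, 0 ≤ 1 - Real.exp (-Dd x p r) := fun r => by
    have : Real.exp (-Dd x p r) ≤ 1 := Real.exp_le_one_iff.2 (by linarith [hD0 r])
    linarith
  have hF1 : ∀ r, 1 - Real.exp (-Dd x p r) ≤ 1 := fun r => by
    linarith [Real.exp_pos (-Dd x p r)]
  have h1ε : 0 < 1 - ε := by linarith
  let G : Fin n → ℝ := fun v => (1 - ε) * (1 - Real.exp (-Dd x p (x v))) / Dd x p (x v)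
  have hlow := PConn_lower n root x p hp h0 (fun r s => (h1 r s).trans hε.le) G
    (fun v => div_nonneg (mul_nonneg h1ε.le (hF0 _)) (hD0 _)) (by
      intro v a hv hav
      have := hG_lemma (fun a b : Fin n => p (x a) (x b)) hε hε0 (fun _ _ => h0 _ _)
        (fun _ _ => h1 _ _) v a hav (hDv v hv)
        (le_of_eq (Finset.sum_congr rfl fun b _ => hp _ _))
      rw [hp (x v) (x a)]
      exact this)
  refine le_trans ?_ hlow
  set L := (lapMat root (fun v a => if v = root then
      (if a = root then 1 else 0) else if a = v then 0 else p (x v) (x a))).det with hL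
  have hred := det_reduce root x p (fun v hv => (hDv v hv).ne')
  rw [← hL] at hred
  have hrat := ratio_ge root x p hp h0 hm hm1 hadj hM hM1
  set Q := ∏ t, ∑ u, WW root x p t u with hQ
  have hQpos : 0 < Q := by
    refine Finset.prod_pos fun t _ => ?_
    cases t with
    | none => rw [WW_sum_none]; norm_num
    | some r =>
      rw [WW_sum]
      split_ifs with hr
      · norm_num
      · have : ∃ v, v ≠ root ∧ x v = r := by
          by_contra hne
          push Not at hne
          apply hr
          unfold kk
          refine Finset.sum_eq_zero fun a ha => ?_
          simp [hne a (Finset.ne_of_mem_erase ha)]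
        obtain ⟨v, hvr, rfl⟩ := this
        exact hDv v hvr
  have hPD : 0 < ∏ v ∈ Finset.univ.erase root, Dd x p (x v) :=
    Finset.prod_pos fun v hv => hDv v (Finset.ne_of_mem_erase hv)
  have hLge : (m / M) ^ Fintype.card S * ∏ v ∈ Finset.univ.erase root, Dd x p (x v) ≤ L := by
    have h3 := mul_le_mul_of_nonneg_left hrat hPD.le
    rw [← hred] at h3
    have h4 : ((m / M) ^ Fintype.card S * ∏ v ∈ Finset.univ.erase root, Dd x p (x v)) * Q ≤ L * Q := by
      linarith
    exact le_of_mul_le_mul_right h4 hQpos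
  have hGnn : 0 ≤ ∏ v ∈ Finset.univ.erase root, G v := Finset.prod_nonneg fun v _ =>
    div_nonneg (mul_nonneg h1ε.le (hF0 _)) (hD0 _)
  refine le_trans ?_ (mul_le_mul_of_nonneg_left hLge hGnn)
  have e3 : (∏ v ∈ Finset.univ.erase root, G v) * ((m / M) ^ Fintype.card S *
      ∏ v ∈ Finset.univ.erase root, Dd x p (x v)) = (m / M) ^ Fintype.card S *
      ∏ v ∈ Finset.univ.erase root, ((1 - ε) * (1 - Real.exp (-Dd x p (x v)))) := by
    rw [mul_left_comm, ← Finset.prod_mul_distrib]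
    congr 1
    refine Finset.prod_congr rfl fun v hv => ?_
    exact div_mul_cancel₀ _ (hDv v (Finset.ne_of_mem_erase hv)).ne'
  rw [e3, mul_assoc]
  have hMpos : 0 < M := by linarith
  refine mul_le_mul_of_nonneg_left ?_ (by positivity)
  have e4 : (1 - ε) ^ n = ∏ _v : Fin n, (1 - ε) := by simp
  rw [e4, ← Finset.prod_mul_distrib, ← Finset.mul_prod_erase _ _ (Finset.mem_univ root)]
  refine mul_le_of_le_one_left (Finset.prod_nonneg fun v _ => mul_nonneg h1ε.le (hF0 _)) ?_
  exact mul_le_one₀ (by linarith) (hF0 _) (hF1 _)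

lemma upper_fin {n : ℕ} (root : Fin n) (x : Fin n → S) (p : S → S → ℝ)
    (hp : ∀ r s, p r s = p s r) (h0 : ∀ r s, 0 ≤ p r s) {ε : ℝ} (hε : ε < 1)
    (h1 : ∀ r s, p r s ≤ ε) :
    (1 - Real.exp (-(Dd x p (x root) / (1 - ε)))) * PConn n x p ≤
      ∏ v, (1 - Real.exp (-(Dd x p (x v) / (1 - ε)))) := by
  have h1ε : 0 < 1 - ε := by linarith
  have hD0 : ∀ r, 0 ≤ Dd x p r := fun r => Finset.sum_nonneg fun a _ => h0 _ _
  have hF0 : ∀ r, 0 ≤ 1 - Real.exp (-(Dd x p r / (1 - ε))) := fun r => by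
    have := div_nonneg (hD0 r) h1ε.le
    have : Real.exp (-(Dd x p r / (1 - ε))) ≤ 1 := Real.exp_le_one_iff.2 (by linarith)
    linarith
  rw [← Finset.mul_prod_erase _ _ (Finset.mem_univ root)]
  refine mul_le_mul_of_nonneg_left ?_ (hF0 _)
  refine (PConn_upper n root x p hp h0 (fun r s => (h1 r s).trans hε.le)).trans ?_
  refine Finset.prod_le_prod (fun v _ => ?_) (fun v _ => ?_)
  · rw [sub_nonneg]
    exact Finset.prod_le_one (fun a _ => by linarith [h1 (x a) (x v)])
      (fun a _ => by linarith [h0 (x a) (x v)])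
  · have h2 := prod_ge_exp (Finset.univ.erase v) (fun a => p (x a) (x v)) hε
      (fun _ => h0 _ _) (fun _ => h1 _ _)
    have h3 : ∑ a ∈ Finset.univ.erase v, p (x a) (x v) ≤ Dd x p (x v) := by
      unfold Dd
      refine (Finset.sum_le_sum_of_subset_of_nonneg (Finset.erase_subset v Finset.univ)
        (fun a _ _ => h0 _ _)).trans (le_of_eq (Finset.sum_congr rfl fun b _ => hp _ _))
    have h4 : Real.exp (-(Dd x p (x v) / (1 - ε))) ≤
        Real.exp (-((∑ a ∈ Finset.univ.erase v, p (x a) (x v)) / (1 - ε))) := by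
      apply Real.exp_le_exp.2
      rw [neg_le_neg_iff]
      gcongr
    linarith

end fin

lemma sum_compat {S : Type*} [Fintype S] {M : Type*} [AddCommMonoid M] (k : S → ℕ) (F : S → M) :
    ∑ i, F (compatVec k i) = ∑ s, k s • F s := by
  have h1 : ∑ i, F (compatVec k i) = ((compatList k).map F).sum := by
    unfold compatVec
    rw [← Fin.sum_univ_fun_getElem]
    exact Fintype.sum_equiv (finCongr (compatList_length k).symm) _ _ (fun i => rfl)
  rw [h1]
  have h2 : ((compatList k).map F).sum = ((∑ s : S, (k s) • ({s} : Multiset S)).map F).sum := by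
    rw [← Multiset.sum_coe, ← Multiset.map_coe, compatList, Multiset.coe_toList]
  rw [h2]
  have h3 : ∀ T : Finset S, ((∑ s ∈ T, (k s) • ({s} : Multiset S)).map F).sum
      = ∑ s ∈ T, k s • F s := by
    intro T
    induction T using Finset.induction_on with
    | empty => simp
    | insert a T ha ih =>
      rw [Finset.sum_insert ha, Finset.sum_insert ha, Multiset.map_add, Multiset.sum_add, ih]
      simp [Multiset.map_nsmul, Multiset.sum_nsmul]
  exact h3 _

lemma prod_compat {S : Type*} [Fintype S] {M : Type*} [CommMonoid M] (k : S → ℕ) (F : S → M) :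
    ∏ i, F (compatVec k i) = ∏ s, F s ^ k s := by
  exact sum_compat (M := Additive M) k F

lemma tau_pos {S : Type*} [Fintype S] (κ : S → S → ℝ) (hκ0 : ∀ r s, 0 ≤ κ r s) (hκs : ∀ r s, κ r s = κ s r)
    (k : S → ℕ) (h : 0 < tau κ k) :
    ∃ root, RAll root (fun a b => 0 < κ (compatVec k a) (compatVec k b)) := by
  unfold tau treeWeight at h
  obtain ⟨E, hE, hne⟩ := Finset.exists_ne_zero_of_sum_ne_zero h.ne'
  simp only [Finset.mem_filter] at hE
  have hc := hE.2.1
  obtain ⟨root⟩ := hc.nonempty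
  refine ⟨root, fun v => ?_⟩
  rw [Finset.prod_ne_zero_iff] at hne
  refine rtg_mono ?_ ((conn_iff root E).1 hc v)
  rintro a b (hab | hab)
  · exact lt_of_le_of_ne (hκ0 _ _) (hne _ hab).symm
  · rw [hκs]; exact lt_of_le_of_ne (hκ0 _ _) (hne _ hab).symm

end MC

namespace MC

lemma logN_tendsto {c : ℝ} (hc : 0 < c) :
    Tendsto (fun N : ℕ => (N : ℝ)⁻¹ * Real.log (c / N)) atTop (nhds 0) := by
  have h1 : Tendsto (fun x : ℝ => Real.log x / x) atTop (nhds 0) :=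
    Real.isLittleO_log_id_atTop.tendsto_div_nhds_zero
  have h2 := h1.comp (tendsto_natCast_atTop_atTop (R := ℝ))
  have h3 : Tendsto (fun N : ℕ => (N : ℝ)⁻¹ * Real.log c) atTop (nhds (0 * Real.log c)) :=
    (tendsto_inv_atTop_nhds_zero_nat (𝕜 := ℝ)).mul_const _
  have h4 := h3.sub h2
  simp only [zero_mul, sub_zero] at h4
  refine h4.congr' ?_
  filter_upwards [eventually_gt_atTop 0] with N hN
  have : (N : ℝ) ≠ 0 := by positivity
  simp only [Function.comp]
  rw [Real.log_div hc.ne' this]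
  ring

lemma seqlim {k : ℕ → ℕ} {F : ℕ → ℝ} {y L c : ℝ}
    (hk : Tendsto (fun N => (k N : ℝ) / N) atTop (nhds y))
    (hF : Tendsto F atTop (nhds L)) (hb : y = 0 → ∃ C : ℕ, ∀ N, k N ≤ C) (hc : 0 < c)
    (hlow : ∀ᶠ N : ℕ in atTop, k N = 0 ∨ c / N ≤ F N) (hF1 : ∀ᶠ N in atTop, F N ≤ 1)
    (hL : y ≠ 0 → L ≠ 0) :
    Tendsto (fun N => (k N : ℝ) / N * Real.log (F N)) atTop (nhds (y * Real.log L)) := by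
  by_cases hy : y = 0
  · obtain ⟨C, hC⟩ := hb hy
    rw [hy, zero_mul]
    have h := ((logN_tendsto hc).abs.const_mul (C : ℝ))
    rw [abs_zero, mul_zero] at h
    refine squeeze_zero_norm' ?_ h
    filter_upwards [hlow, hF1, eventually_gt_atTop 0] with N h1 h2 hN
    have hN' : (0 : ℝ) < N := by positivity
    rcases h1 with h1 | h1
    · simp [h1]; positivity
    · have hcN : 0 < c / N := by positivity
      have hF0 : 0 < F N := hcN.trans_le h1
      rw [Real.norm_eq_abs, abs_mul, abs_mul, abs_of_nonneg (by positivity : (0:ℝ) ≤ (k N : ℝ) / N),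
        abs_of_nonneg (by positivity : (0:ℝ) ≤ (N : ℝ)⁻¹), ← mul_assoc, ← div_eq_mul_inv]
      have h3 : |Real.log (F N)| ≤ |Real.log (c / N)| := by
        rw [abs_of_nonpos (Real.log_nonpos hF0.le h2),
          abs_of_nonpos (Real.log_nonpos hcN.le (h1.trans h2))]
        have := Real.log_le_log hcN h1
        linarith
      have h4 : (k N : ℝ) ≤ C := by exact_mod_cast hC N
      gcongr
  · exact hk.mul (hF.log (hL hy))

lemma one_sub_exp_ge {u : ℝ} (h0 : 0 ≤ u) (h1 : u ≤ 1) : u / 2 ≤ 1 - Real.exp (-u) := by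
  have h2 := Real.add_one_le_exp u
  have h3 : Real.exp (-u) * Real.exp u = 1 := by rw [← Real.exp_add]; simp
  have h4 := Real.exp_pos (-u)
  have h5 : Real.exp (-u) * (u + 1) ≤ 1 := (mul_le_mul_of_nonneg_left h2 h4.le).trans h3.le
  have h6 : Real.exp (-u) ≤ 1 := Real.exp_le_one_iff.2 (by linarith)
  nlinarith [mul_nonneg h0 (sub_nonneg.2 h1)]

lemma one_sub_exp_mono {u v : ℝ} (h : u ≤ v) : 1 - Real.exp (-u) ≤ 1 - Real.exp (-v) := by
  have := Real.exp_le_exp.2 (neg_le_neg h)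
  linarith

lemma log_prod_pow {S : Type*} [Fintype S] (F : S → ℝ) (k : S → ℕ) (h : ∀ r, k r = 0 ∨ 0 < F r) :
    0 < ∏ r, F r ^ k r ∧ Real.log (∏ r, F r ^ k r) = ∑ r, (k r : ℝ) * Real.log (F r) := by
  have h1 : ∀ r, 0 < F r ^ k r := by
    intro r
    rcases h r with h | h
    · simp [h]
    · positivity
  refine ⟨Finset.prod_pos fun r _ => h1 r, ?_⟩
  rw [Real.log_prod (fun r _ => (h1 r).ne')]
  simp [Real.log_pow]

/-- the mean degree -/
def DN {S : Type*} [Fintype S] (q : S → S → ℝ) (N : ℕ) (k : S → ℕ) (r : S) : ℝ :=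
  ∑ s, q r s * ((k s : ℝ) / N)

lemma main_fin {S : Type*} [Fintype S] [DecidableEq S] (κ : S → S → ℝ)
    (hκsym : ∀ r s, κ r s = κ s r) (hκ0 : ∀ r s, 0 ≤ κ r s)
    (q : S → S → ℝ) (hqsym : ∀ r s, q r s = q s r) (hq0 : ∀ r s, 0 ≤ q r s)
    (N : ℕ) (hN : 0 < N) (k : S → ℕ) (B c0 M : ℝ) (hB : ∀ r s, q r s ≤ B) (hB0 : 0 ≤ B)
    (hBN : B / N ≤ 1 / 2) (hc0 : 0 < c0) (hc1 : c0 ≤ 1) (hc : ∀ r s, 0 < κ r s → c0 ≤ q r s)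
    (htau : 0 < tau κ k) (hk2 : ∃ r, 2 ≤ k r) (hM : ∀ r, DN q N k r ≤ M) (hM1 : 1 ≤ M) :
    (∀ r, k r = 0 ∨ c0 / N ≤ DN q N k r) ∧ 0 < pN q N k ∧
    (Fintype.card S * Real.log (c0 / M / N) + (∑ s, (k s : ℝ)) * Real.log (1 - B / N)
      + ∑ r, (k r : ℝ) * Real.log (1 - Real.exp (-DN q N k r)) ≤ Real.log (pN q N k)) ∧
    (Real.log (pN q N k) ≤ - Real.log (c0 / 2 / N) +
      ∑ r, (k r : ℝ) * Real.log (1 - Real.exp (-(DN q N k r / (1 - B / N))))) := by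
  have hN' : (0 : ℝ) < N := by positivity
  have hN1 : (1 : ℝ) ≤ N := by exact_mod_cast hN
  set p : S → S → ℝ := fun r s => min 1 (q r s / N) with hpdef
  have hpe : ∀ r s, p r s = q r s / N := by
    intro r s
    refine min_eq_right ?_
    have : q r s / N ≤ B / N := by have := hB r s; gcongr
    linarith
  have hps : ∀ r s, p r s = p s r := fun r s => by rw [hpe, hpe, hqsym]
  have hp0 : ∀ r s, 0 ≤ p r s := fun r s => by
    rw [hpe]; exact div_nonneg (hq0 _ _) hN'.le
  have hpB : ∀ r s, p r s ≤ B / N := fun r s => by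
    rw [hpe]; have := hB r s; gcongr
  set x := compatVec k with hx
  have hD : ∀ r, Dd x p r = DN q N k r := by
    intro r
    unfold Dd DN
    rw [sum_compat k (fun s => p r s)]
    refine Finset.sum_congr rfl fun s _ => ?_
    rw [hpe, nsmul_eq_mul]; ring
  obtain ⟨root, hroot⟩ := tau_pos κ hκ0 hκsym k htau
  set m : ℝ := c0 / N with hm
  have hmpos : 0 < m := by positivity
  have hm1 : m ≤ 1 := (div_le_one hN').2 (hc1.trans hN1)
  have hadj : RAll root (fun a b => m ≤ p (x a) (x b)) := by
    intro v
    refine rtg_mono ?_ (hroot v)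
    intro a b hab
    rw [hpe]
    have := hc _ _ hab
    rw [hm]; gcongr
  have hn2 : 2 ≤ ∑ s, k s := by
    obtain ⟨r, hr⟩ := hk2
    exact hr.trans (Finset.single_le_sum (f := k) (fun _ _ => Nat.zero_le _) (Finset.mem_univ r))
  have hDv : ∀ v, m ≤ Dd x p (x v) := by
    intro v
    by_cases hv : v = root
    · have : ∃ w : Fin (∑ s, k s), w ≠ root := by
        have : Nontrivial (Fin (∑ s, k s)) := Fin.nontrivial_iff_two_le.2 hn2
        exact exists_ne root
      obtain ⟨w, hw⟩ := this
      rcases (hadj w).cases_head with h | ⟨c, hc', _⟩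
      · exact absurd h.symm hw
      · rw [hv]
        exact hc'.trans (Finset.single_le_sum (f := fun a => p (x root) (x a))
          (fun a _ => hp0 _ _) (Finset.mem_univ c))
    · exact Dd_ge root x p hps hp0 hadj v hv
  have hA : ∀ r, k r = 0 ∨ c0 / N ≤ DN q N k r := by
    intro r
    by_cases hr : ∃ i, x i = r
    · obtain ⟨i, rfl⟩ := hr
      right
      rw [← hD]; exact hDv i
    · left
      have h := sum_compat k (fun s => if s = r then (1 : ℕ) else 0)
      push Not at hr
      rw [Finset.sum_eq_zero (fun i _ => if_neg (hr i))] at h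
      simpa using h.symm
  have hlow := lower_fin root x p hps hp0 (ε := B / N) (by positivity) (by linarith) hpB hmpos hm1
    hadj (M := M) (fun r => by rw [hD]; exact hM r) hM1
  have hup := upper_fin root x p hps hp0 (ε := B / N) (by linarith) hpB
  rw [prod_compat k (fun s => 1 - Real.exp (-Dd x p s))] at hlow
  rw [prod_compat k (fun s => 1 - Real.exp (-(Dd x p s / (1 - B / N))))] at hup
  simp only [hD] at hlow hup
  have hpN : PConn (∑ s, k s) x p = pN q N k := rfl
  rw [hpN] at hlow hup
  have hε : 0 < 1 - B / N := by linarith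
  have hεle : 1 - B / N ≤ 1 := by have : 0 ≤ B / N := by positivity
                                  linarith
  have hdiv : ∀ u : ℝ, 0 ≤ u → u ≤ u / (1 - B / N) := fun u hu => by
    rw [le_div_iff₀ hε]; nlinarith
  have hmF := one_sub_exp_ge hmpos.le hm1
  have hFp : ∀ u, m ≤ u → m / 2 ≤ 1 - Real.exp (-u) := fun u hu =>
    hmF.trans (one_sub_exp_mono hu)
  have hFp' : ∀ u, m ≤ u → m / 2 ≤ 1 - Real.exp (-(u / (1 - B / N))) := fun u hu =>
    hFp _ (hu.trans (hdiv u (hmpos.le.trans hu)))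
  have hm2 : 0 < m / 2 := by positivity
  obtain ⟨hP1, hL1⟩ := log_prod_pow (fun r => 1 - Real.exp (-DN q N k r)) k
    (fun r => (hA r).imp id fun h => hm2.trans_le (hFp _ h))
  obtain ⟨hP2, hL2⟩ := log_prod_pow (fun r => 1 - Real.exp (-(DN q N k r / (1 - B / N)))) k
    (fun r => (hA r).imp id fun h => hm2.trans_le (hFp' _ h))
  have hM0 : 0 < M := by linarith
  have hpos : 0 < pN q N k := lt_of_lt_of_le (by positivity) hlow
  refine ⟨hA, hpos, ?_, ?_⟩
  · have h := Real.log_le_log (by positivity) hlow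
    rw [Real.log_mul (by positivity) hP1.ne', Real.log_mul (by positivity) (by positivity),
      Real.log_pow, Real.log_pow, hL1] at h
    have e : c0 / M / N = m / M := by rw [hm]; field_simp
    rw [e]
    push_cast at h
    exact h
  · have h5 : m / 2 * pN q N k ≤ ∏ r, (1 - Real.exp (-(DN q N k r / (1 - B / N)))) ^ k r := by
      refine le_trans ?_ hup
      refine mul_le_mul_of_nonneg_right ?_ hpos.le
      have := hFp' (Dd x p (x root)) (hDv root)
      rwa [hD] at this
    have h := Real.log_le_log (by positivity) h5
    rw [Real.log_mul hm2.ne' hpos.ne', hL2] at h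
    have e : c0 / 2 / N = m / 2 := by rw [hm]; field_simp
    rw [e]
    linarith

end MC

namespace MC

lemma elog_term {y u : ℝ} (hy : 0 ≤ y) (hu : 0 ≤ u) (h : ¬ (0 < y ∧ u = 0)) :
    (y : EReal) * elog (1 - Real.exp (-u)) = ((y * Real.log (1 - Real.exp (-u)) : ℝ) : EReal) := by
  rcases hy.eq_or_lt with h0 | h0
  · simp [← h0]
  · have hu' : 0 < u := lt_of_le_of_ne hu (fun h' => h ⟨h0, h'.symm⟩)
    have : Real.exp (-u) < 1 := Real.exp_lt_one_iff.2 (by linarith)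
    rw [elog, if_neg (by linarith), EReal.coe_mul]

lemma elog_term_bot {y : ℝ} (hy : 0 < y) :
    (y : EReal) * elog (1 - Real.exp (-0)) = ⊥ := by
  simp [elog, EReal.coe_mul_bot_of_pos hy]

lemma coe_sum_ereal {S : Type*} (T : Finset S) (f : S → ℝ) :
    ((∑ r ∈ T, f r : ℝ) : EReal) = ∑ r ∈ T, (f r : EReal) := by
  induction T using Finset.induction_on with
  | empty => simp
  | insert a T ha ih => rw [Finset.sum_insert ha, Finset.sum_insert ha, EReal.coe_add, ih]

lemma log_one_sub_exp_nonpos {u : ℝ} (hu : 0 ≤ u) : Real.log (1 - Real.exp (-u)) ≤ 0 := by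
  have : Real.exp (-u) ≤ 1 := Real.exp_le_one_iff.2 (by linarith)
  exact Real.log_nonpos (by linarith) (by linarith [Real.exp_pos (-u)])

lemma sum_fin {S : Type*} [Fintype S] (y u : S → ℝ) (hy : ∀ r, 0 ≤ y r) (hu : ∀ r, 0 ≤ u r)
    (h : ¬ ∃ r, 0 < y r ∧ u r = 0) :
    ∑ r, (y r : EReal) * elog (1 - Real.exp (-u r))
      = ((∑ r, y r * Real.log (1 - Real.exp (-u r)) : ℝ) : EReal) := by
  rw [coe_sum_ereal]
  exact Finset.sum_congr rfl fun r _ => elog_term (hy r) (hu r) (fun h' => h ⟨r, h'⟩)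

lemma sum_bot {S : Type*} [Fintype S] (y u : S → ℝ) (h : ∃ r, 0 < y r ∧ u r = 0) :
    ∑ r, (y r : EReal) * elog (1 - Real.exp (-u r)) = ⊥ := by
  obtain ⟨r, hr, hu⟩ := h
  rw [← Finset.add_sum_erase _ _ (Finset.mem_univ r), hu, elog_term_bot hr, EReal.bot_add]

section asym
variable {S : Type*} [Fintype S] [DecidableEq S] [Nonempty S]

lemma setup (κ : S → S → ℝ) (hκsym : ∀ r s, κ r s = κ s r) (hκ0 : ∀ r s, 0 ≤ κ r s)
    (κN : ℕ → S → S → ℝ) (hκNsym : ∀ N r s, κN N r s = κN N s r)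
    (hκN0 : ∀ N r s, 0 ≤ κN N r s)
    (hκNconv : ∀ r s, Tendsto (fun N => κN N r s) atTop (nhds (κ r s)))
    (y : S → ℝ) (hy0 : ∀ r, 0 ≤ y r) (hyne : y ≠ 0)
    (k : ℕ → S → ℕ)
    (hk : ∀ r, Tendsto (fun N => (k N r : ℝ) / N) atTop (nhds (y r)))
    (htau : ∀ᶠ N in atTop, 0 < tau κ (k N)) :
    ∃ B c0 M : ℝ, 0 ≤ B ∧ 0 < c0 ∧ c0 ≤ 1 ∧ 1 ≤ M ∧ ∀ᶠ N : ℕ in atTop,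
    0 < N ∧ B / N ≤ 1 / 2 ∧
    (∀ r, k N r = 0 ∨ c0 / N ≤ DN (κN N) N (k N) r) ∧ 0 < pN (κN N) N (k N) ∧
    (Fintype.card S * Real.log (c0 / M / N) + (∑ s, (k N s : ℝ)) * Real.log (1 - B / N)
      + ∑ r, (k N r : ℝ) * Real.log (1 - Real.exp (-DN (κN N) N (k N) r))
        ≤ Real.log (pN (κN N) N (k N))) ∧
    (Real.log (pN (κN N) N (k N)) ≤ - Real.log (c0 / 2 / N) +
      ∑ r, (k N r : ℝ) * Real.log (1 - Real.exp (-(DN (κN N) N (k N) r / (1 - B / N))))) := by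
  have hD : ∀ r, Tendsto (fun N => DN (κN N) N (k N) r) atTop (nhds (∑ s, κ r s * y s)) :=
    fun r => tendsto_finsetSum _ fun s _ => (hκNconv r s).mul (hk s)
  let B : ℝ := 1 + ∑ r, ∑ s, κ r s
  let M : ℝ := 1 + ∑ r, ∑ s, κ r s * y s
  have hle : ∀ r s, κ r s < B := by
    intro r s
    have h1 := Finset.single_le_sum (f := fun s => κ r s) (fun s _ => hκ0 r s) (Finset.mem_univ s)
    have h2 := Finset.single_le_sum (f := fun r => ∑ s, κ r s)
      (fun r _ => Finset.sum_nonneg fun s _ => hκ0 r s) (Finset.mem_univ r)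
    simp only [B]; linarith
  have hleM : ∀ r, ∑ s, κ r s * y s < M := by
    intro r
    have h2 := Finset.single_le_sum (f := fun r => ∑ s, κ r s * y s)
      (fun r _ => Finset.sum_nonneg fun s _ => mul_nonneg (hκ0 r s) (hy0 s)) (Finset.mem_univ r)
    simp only [M]; linarith
  have hB0 : 0 ≤ B := (hκ0 (Classical.arbitrary S) (Classical.arbitrary S)).trans (hle _ _).le
  have hM1 : 1 ≤ M := by
    have : 0 ≤ ∑ r, ∑ s, κ r s * y s := Finset.sum_nonneg fun r _ =>
      Finset.sum_nonneg fun s _ => mul_nonneg (hκ0 r s) (hy0 s)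
    simp only [M]; linarith
  obtain ⟨c0, hc0, hc1, hc⟩ : ∃ c0 : ℝ, 0 < c0 ∧ c0 ≤ 1 ∧ ∀ r s, 0 < κ r s → c0 < κ r s := by
    have h : ∀ q : S × S, ∀ᶠ c in nhdsWithin (0 : ℝ) (Set.Ioi 0), 0 < κ q.1 q.2 → c < κ q.1 q.2 := by
      intro q
      by_cases h : 0 < κ q.1 q.2
      · filter_upwards [mem_nhdsWithin_of_mem_nhds (Iio_mem_nhds h)] with c hc _ using hc
      · exact Eventually.of_forall fun c h' => absurd h' h
    have h2 : ∀ᶠ c in nhdsWithin (0 : ℝ) (Set.Ioi 0), c < 1 :=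
      mem_nhdsWithin_of_mem_nhds (Iio_mem_nhds one_pos)
    obtain ⟨c, ⟨h3, h4⟩, h5⟩ := (((eventually_all.2 h).and h2).and self_mem_nhdsWithin).exists
    exact ⟨c, h5, h4.le, fun r s => h3 (r, s)⟩
  refine ⟨B, c0, M, hB0, hc0, hc1, hM1, ?_⟩
  have e1 : ∀ᶠ N in atTop, ∀ r s, κN N r s ≤ B := by
    refine eventually_all.2 fun r => eventually_all.2 fun s => ?_
    exact ((hκNconv r s).eventually_lt_const (hle r s)).mono fun _ h => h.le
  have e2 : ∀ᶠ N in atTop, ∀ r s, 0 < κ r s → c0 ≤ κN N r s := by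
    refine eventually_all.2 fun r => eventually_all.2 fun s => ?_
    by_cases h : 0 < κ r s
    · exact ((hκNconv r s).eventually_const_lt (hc r s h)).mono fun _ h _ => h.le
    · exact Eventually.of_forall fun _ h' => absurd h' h
  have e3 : ∀ᶠ N : ℕ in atTop, B / N ≤ 1 / 2 :=
    ((tendsto_const_div_atTop_nhds_zero_nat B).eventually_lt_const
      (by norm_num : (0 : ℝ) < 1 / 2)).mono fun _ h => h.le
  have e4 : ∀ᶠ N in atTop, ∀ r, DN (κN N) N (k N) r ≤ M := by
    refine eventually_all.2 fun r => ?_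
    exact ((hD r).eventually_lt_const (hleM r)).mono fun _ h => h.le
  have e5 : ∀ᶠ N in atTop, ∃ r, 2 ≤ k N r := by
    obtain ⟨r, hr⟩ : ∃ r, y r ≠ 0 := by
      by_contra h
      push Not at h
      exact hyne (funext h)
    have hr' : 0 < y r := lt_of_le_of_ne (hy0 r) hr.symm
    have h1 : Tendsto (fun N : ℕ => (k N r : ℝ) / N * N) atTop atTop :=
      (hk r).pos_mul_atTop hr' tendsto_natCast_atTop_atTop
    filter_upwards [h1.eventually_ge_atTop 2, eventually_gt_atTop 0] with N h2 hN
    have hN' : (N : ℝ) ≠ 0 := by positivity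
    rw [div_mul_cancel₀ _ hN'] at h2
    exact ⟨r, by exact_mod_cast h2⟩
  filter_upwards [e1, e2, e3, e4, e5, htau, eventually_gt_atTop 0] with N h1 h2 h3 h4 h5 h6 h7
  exact ⟨h7, h3, main_fin κ hκsym hκ0 (κN N) (hκNsym N) (hκN0 N) N h7 (k N) B c0 M h1 hB0 h3 hc0 hc1
    h2 h6 h5 h4 hM1⟩

end asym

end MC
/-- asymptotics for connection probabilities of macroscopic clusters. -/
theorem macroscopic_connProb_asymptotics
    {S : Type*} [Fintype S] [DecidableEq S] [Nonempty S]
    (κ : S → S → ℝ) (hκsym : ∀ r s, κ r s = κ s r) (hκ0 : ∀ r s, 0 ≤ κ r s)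
    (κN : ℕ → S → S → ℝ) (hκNsym : ∀ N r s, κN N r s = κN N s r)
    (hκN0 : ∀ N r s, 0 ≤ κN N r s)
    (hκNconv : ∀ r s, Tendsto (fun N => κN N r s) atTop (nhds (κ r s)))
    (y : S → ℝ) (hy0 : ∀ r, 0 ≤ y r) (hy1 : ∀ r, y r ≤ 1) (hyne : y ≠ 0)
    (k : ℕ → S → ℕ)
    (hk : ∀ r, Tendsto (fun N => (k N r : ℝ) / N) atTop (nhds (y r)))
    (htau : ∀ᶠ N in atTop, 0 < tau κ (k N))
    (hbdd : ∀ r, y r = 0 → ∃ C : ℕ, ∀ N, k N r ≤ C) :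
    Tendsto (fun N : ℕ => ((N : ℝ)⁻¹ : EReal) * elog (pN (κN N) N (k N))) atTop
        (nhds (∑ r : S, (y r : EReal) * elog (1 - Real.exp (-(∑ s : S, κ r s * y s))))) ∧
      (∑ r : S, (y r : EReal) * elog (1 - Real.exp (-(∑ s : S, κ r s * y s)))) ≤ 0 ∧
      ((∑ r : S, (y r : EReal) * elog (1 - Real.exp (-(∑ s : S, κ r s * y s)))) = ⊥ ↔
        ∃ r, 0 < y r ∧ (∑ s : S, κ r s * y s) = 0) := by
  have hu0 : ∀ r, 0 ≤ ∑ s, κ r s * y s := fun r =>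
    Finset.sum_nonneg fun s _ => mul_nonneg (hκ0 r s) (hy0 s)
  have hfin := MC.sum_fin y (fun r => ∑ s, κ r s * y s) hy0 hu0
  have hbot := MC.sum_bot y (fun r => ∑ s, κ r s * y s)
  obtain ⟨B, c0, M, hB0, hc0, hc1, hM1, hev⟩ := MC.setup κ hκsym hκ0 κN hκNsym hκN0 hκNconv y hy0
    hyne k hk htau
  have hD : ∀ r, Tendsto (fun N => MC.DN (κN N) N (k N) r) atTop (nhds (∑ s, κ r s * y s)) :=
    fun r => tendsto_finsetSum _ fun s _ => (hκNconv r s).mul (hk s)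
  have hBN : Tendsto (fun N : ℕ => 1 - B / N) atTop (nhds (1 : ℝ)) := by
    simpa using (tendsto_const_div_atTop_nhds_zero_nat B).const_sub 1
  have hD' : ∀ r, Tendsto (fun N : ℕ => MC.DN (κN N) N (k N) r / (1 - B / N)) atTop
      (nhds (∑ s, κ r s * y s)) := fun r => by
    have h := (hD r).div hBN one_ne_zero
    rw [div_one] at h
    exact h
  have hexp : ∀ (f : ℕ → ℝ) (l : ℝ), Tendsto f atTop (nhds l) →
      Tendsto (fun N => 1 - Real.exp (-f N)) atTop (nhds (1 - Real.exp (-l))) := fun f l h =>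
    ((Real.continuous_exp.tendsto _).comp h.neg).const_sub 1
  have hDnn : ∀ N r, 0 ≤ MC.DN (κN N) N (k N) r := fun N r =>
    Finset.sum_nonneg fun s _ => mul_nonneg (hκN0 N r s) (by positivity)
  have hlow1 : ∀ᶠ N : ℕ in atTop, ∀ r, k N r = 0 ∨
      c0 / 2 / N ≤ 1 - Real.exp (-MC.DN (κN N) N (k N) r) := by
    filter_upwards [hev] with N h r
    obtain ⟨hN, hb, hA, -⟩ := h
    have hN1 : (1 : ℝ) ≤ N := by exact_mod_cast hN
    refine (hA r).imp id fun h => ?_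
    have h1 := MC.one_sub_exp_ge (u := c0 / N) (by positivity)
      ((div_le_one (by linarith)).2 (hc1.trans hN1))
    have e : c0 / 2 / N = c0 / N / 2 := by ring
    rw [e]
    exact h1.trans (MC.one_sub_exp_mono h)
  have hlow2 : ∀ᶠ N : ℕ in atTop, ∀ r, k N r = 0 ∨
      c0 / 2 / N ≤ 1 - Real.exp (-(MC.DN (κN N) N (k N) r / (1 - B / N))) := by
    filter_upwards [hlow1, hev] with N h1 h r
    refine (h1 r).imp id fun h1 => h1.trans (MC.one_sub_exp_mono ?_)
    obtain ⟨hN, hb, -⟩ := h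
    have hb0 : 0 ≤ B / N := by positivity
    rw [le_div_iff₀ (by linarith)]
    nlinarith [hDnn N r]
  have hle1 : ∀ u : ℝ, 1 - Real.exp (-u) ≤ 1 := fun u => by linarith [Real.exp_pos (-u)]
  have hnn2 : ∀ᶠ N : ℕ in atTop, ∀ r, 0 ≤ MC.DN (κN N) N (k N) r / (1 - B / N) := by
    filter_upwards [hev] with N h r
    exact div_nonneg (hDnn N r) (by linarith [h.2.1])
  have hEq : (fun N : ℕ => ((N : ℝ)⁻¹ : EReal) * elog (pN (κN N) N (k N))) =ᶠ[atTop]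
      fun N : ℕ => (((N : ℝ)⁻¹ * Real.log (pN (κN N) N (k N)) : ℝ) : EReal) := by
    filter_upwards [hev] with N h
    obtain ⟨-, -, -, hp, -⟩ := h
    rw [elog, if_neg (not_le.2 hp), EReal.coe_mul, EReal.coe_inv]
  have hlogU := (MC.logN_tendsto (c := c0 / 2) (by positivity)).neg
  rw [neg_zero] at hlogU
  by_cases hbad : ∃ r, 0 < y r ∧ (∑ s : S, κ r s * y s) = 0
  · rw [hbot hbad]
    refine ⟨?_, bot_le, by simp [hbad]⟩
    rw [tendsto_congr' hEq, EReal.tendsto_coe_nhds_bot_iff]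
    obtain ⟨r, hr, hur⟩ := hbad
    have hF := hexp _ _ (hD' r)
    rw [hur] at hF
    simp only [neg_zero, Real.exp_zero, sub_self] at hF
    have hkpos : ∀ᶠ N in atTop, k N r ≠ 0 := by
      filter_upwards [(hk r).eventually_const_lt hr] with N hN h0
      simp [h0] at hN
    have hF' : Tendsto (fun N : ℕ => 1 - Real.exp (-(MC.DN (κN N) N (k N) r / (1 - B / N)))) atTop
        (nhdsWithin 0 (Set.Ioi 0)) := by
      refine tendsto_nhdsWithin_iff.2 ⟨hF, ?_⟩
      filter_upwards [hkpos, hlow2, hev] with N h1 h2 h3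
      have hN := h3.1
      have : 0 < c0 / 2 / N := by positivity
      exact this.trans_le ((h2 r).resolve_left h1)
    have h1 := (hk r).pos_mul_atBot hr (Real.tendsto_log_nhdsGT_zero.comp hF')
    have h2 := hlogU.add_atBot h1
    refine tendsto_atBot_mono' _ ?_ h2
    filter_upwards [hev, hnn2] with N h hnn
    obtain ⟨hN, -, -, -, -, hup⟩ := h
    have hN' : (0 : ℝ) < N := by positivity
    have h3 : ∑ r, (k N r : ℝ) * Real.log (1 - Real.exp (-(MC.DN (κN N) N (k N) r / (1 - B / N))))
        ≤ (k N r : ℝ) * Real.log (1 - Real.exp (-(MC.DN (κN N) N (k N) r / (1 - B / N)))) := by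
      rw [← Finset.add_sum_erase _ _ (Finset.mem_univ r)]
      have : ∑ s ∈ Finset.univ.erase r, (k N s : ℝ) *
          Real.log (1 - Real.exp (-(MC.DN (κN N) N (k N) s / (1 - B / N)))) ≤ 0 :=
        Finset.sum_nonpos fun s _ => mul_nonpos_of_nonneg_of_nonpos (by positivity)
          (MC.log_one_sub_exp_nonpos (hnn s))
      linarith
    have h4 := mul_le_mul_of_nonneg_left (hup.trans (add_le_add_right h3 _)) (inv_nonneg.2 hN'.le)
    refine h4.trans (le_of_eq ?_)
    simp only [Function.comp]
    ring
  · rw [hfin hbad]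
    refine ⟨?_, ?_, by simp [hbad]⟩
    · rw [tendsto_congr' hEq, EReal.tendsto_coe]
      have hL : ∀ r, y r ≠ 0 → 1 - Real.exp (-(∑ s, κ r s * y s)) ≠ 0 := by
        intro r hr
        have h1 : 0 < y r := lt_of_le_of_ne (hy0 r) hr.symm
        have h2 : 0 < ∑ s, κ r s * y s := lt_of_le_of_ne (hu0 r) fun h => hbad ⟨r, h1, h.symm⟩
        have : Real.exp (-(∑ s, κ r s * y s)) < 1 := Real.exp_lt_one_iff.2 (by linarith)
        linarith
      have hc2 : 0 < c0 / 2 := by positivity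
      have hS1 := tendsto_finsetSum Finset.univ fun (r : S) _ => MC.seqlim (hk r) (hexp _ _ (hD r))
        (hbdd r) hc2 (hlow1.mono fun N h => h r) (Eventually.of_forall fun N => hle1 _) (hL r)
      have hS2 := tendsto_finsetSum Finset.univ fun (r : S) _ => MC.seqlim (hk r) (hexp _ _ (hD' r))
        (hbdd r) hc2 (hlow2.mono fun N h => h r) (Eventually.of_forall fun N => hle1 _) (hL r)
      have hlogL := (MC.logN_tendsto (c := c0 / M) (by positivity)).const_mul
        (Fintype.card S : ℝ)
      have hn := (tendsto_finsetSum Finset.univ fun (r : S) _ => hk r).mul (hBN.log one_ne_zero)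
      have hlo := (hlogL.add hn).add hS1
      have hup := hlogU.add hS2
      simp only [Real.log_one, mul_zero, zero_add] at hlo hup
      refine tendsto_of_tendsto_of_tendsto_of_le_of_le' hlo hup ?_ ?_
      · filter_upwards [hev] with N h
        obtain ⟨hN, -, -, -, hl, -⟩ := h
        have hN' : (0 : ℝ) < N := by positivity
        refine le_trans (le_of_eq ?_) (mul_le_mul_of_nonneg_left hl (inv_nonneg.2 hN'.le))
        rw [mul_add, mul_add, Finset.mul_sum, ← mul_assoc _ (∑ s, (k N s : ℝ)), Finset.mul_sum]
        congr 1
        · congr 1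
          · ring
          · congr 1
            exact Finset.sum_congr rfl fun s _ => by ring
        · exact Finset.sum_congr rfl fun s _ => by ring
      · filter_upwards [hev] with N h
        obtain ⟨hN, -, -, -, -, hl⟩ := h
        have hN' : (0 : ℝ) < N := by positivity
        refine le_trans (mul_le_mul_of_nonneg_left hl (inv_nonneg.2 hN'.le)) (le_of_eq ?_)
        rw [mul_add, Finset.mul_sum]
        congr 1
        · ring
        · exact Finset.sum_congr rfl fun s _ => by ring
    · have : ∑ r, y r * Real.log (1 - Real.exp (-(∑ s, κ r s * y s))) ≤ 0 :=
        Finset.sum_nonpos fun r _ => mul_nonpos_of_nonneg_of_nonpos (hy0 r)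
          (MC.log_one_sub_exp_nonpos (hu0 r))
      exact_mod_cast this


end
end

section
/- Let N ≥ 1 and let κ_N be a kernel on S with κ_N(r,s) ≤ N for all r, s ∈ S. Fix m ∈ ℕ₀^S and r ∈ S with m_r ≥ 1. Then ∑_{h ∈ ℕ₀^S : e_r ≤ h ≤ m} [∏_{s∈S} C(m_s − δ_{r,s}, h_s − δ_{r,s})] · p_N(h) · ∏_{s,s̃ ∈ S} (1 − κ_N(s,s̃)/N)^{h_s (m_{s̃} − h_{s̃})} = 1, where e_r is the r-th unit vector of ℕ₀^S, δ_{r,s} is the Kronecker delta, and C(·,·) denotes the binomial coefficient. -/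
open scoped Classical ENNReal
open Filter MeasureTheory

noncomputable section

lemma aux_comp {V : Type*} (G : SimpleGraph V) (v : V) (C : Set V) (hv : v ∈ C) :
    (∀ a, G.Reachable v a ↔ a ∈ C) ↔ (G.induce C).Connected ∧ ∀ a ∈ C, ∀ b, b ∉ C → ¬ G.Adj a b := by
  constructor
  · intro h
    constructor
    · have hC : C = (G.connectedComponentMk v).supp := by
        ext a
        rw [← h a, SimpleGraph.ConnectedComponent.mem_supp_iff, SimpleGraph.ConnectedComponent.eq]
        exact ⟨fun h => h.symm, fun h => h.symm⟩
      rw [hC]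
      exact (G.connectedComponentMk v).connected_toSimpleGraph
    · intro a ha b hb hab
      exact hb ((h b).1 (((h a).2 ha).trans hab.reachable))
  · rintro ⟨h1, h2⟩ a
    constructor
    · rintro ⟨p⟩
      have : ∀ u w, (p : G.Walk u w) → u ∈ C → w ∈ C := by
        intro u w p
        induction p with
        | nil => exact id
        | cons hadj p ih =>
          intro hu
          apply ih
          by_contra hcon
          exact h2 _ hu _ hcon hadj
      exact this _ _ p hv
    · intro ha
      have := h1.preconnected ⟨v, hv⟩ ⟨a, ha⟩
      exact this.map (SimpleGraph.Embedding.induce C).toHom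

def auxD {V : Type*} (C : Finset V) : Finset (Sym2 V) := C.sym2.filter (fun e => ¬ e.IsDiag)

lemma mem_auxD {V : Type*} (C : Finset V) (a b : V) :
    s(a, b) ∈ auxD C ↔ (a ∈ C ∧ b ∈ C) ∧ a ≠ b := by
  simp [auxD]

def auxX {V : Type*} [Fintype V] (C : Finset V) : Finset (Sym2 V) :=
  (C ×ˢ Cᶜ).image (fun p => s(p.1, p.2))

lemma mem_auxX {V : Type*} [Fintype V] (C : Finset V) (a b : V) :
    s(a, b) ∈ auxX C ↔ (a ∈ C ∧ b ∉ C) ∨ (b ∈ C ∧ a ∉ C) := by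
  simp only [auxX, Finset.mem_image, Finset.mem_product, Finset.mem_compl, Prod.exists, Sym2.eq_iff]
  constructor
  · rintro ⟨c, d, h, (⟨rfl, rfl⟩ | ⟨rfl, rfl⟩)⟩ <;> tauto
  · rintro (h | h)
    · exact ⟨a, b, h, by tauto⟩
    · exact ⟨b, a, h, by tauto⟩

def auxF {V : Type*} (w : Sym2 V → ℝ) (E : Finset (Sym2 V)) (e : Sym2 V) : ℝ :=
  if e ∈ E then w e else 1 - w e

def auxP {V : Type*} (w : Sym2 V → ℝ) (C : Finset V) : ℝ :=
  ∑ E ∈ (auxD C).powerset.filter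
    (fun E : Finset (Sym2 V) => ((SimpleGraph.fromEdgeSet (E : Set (Sym2 V))).induce (C : Set V)).Connected),
    ∏ e ∈ auxD C, auxF w E e

lemma aux_split {V : Type*} [Fintype V] (C : Finset V) (f : Sym2 V → ℝ) :
    ∏ e ∈ auxD (Finset.univ : Finset V), f e =
      (∏ e ∈ auxD C, f e) * (∏ e ∈ auxD Cᶜ, f e) * ∏ e ∈ auxX C, f e := by
  have h1 : Disjoint (auxD C) (auxD Cᶜ) := by
    rw [Finset.disjoint_left]
    intro e
    induction e with | _ a b
    simp only [mem_auxD, Finset.mem_compl]; tauto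
  have h2 : Disjoint (auxD C ∪ auxD Cᶜ) (auxX C) := by
    rw [Finset.disjoint_left]
    intro e
    induction e with | _ a b
    simp only [Finset.mem_union, mem_auxD, mem_auxX, Finset.mem_compl]; tauto
  rw [← Finset.prod_union h1, ← Finset.prod_union h2]
  congr 1
  ext e
  induction e with | _ a b
  simp only [Finset.mem_union, mem_auxD, mem_auxX, Finset.mem_compl, Finset.mem_univ, true_and]
  by_cases ha : a ∈ C <;> by_cases hb : b ∈ C <;> simp only [ha, hb] <;> try tauto
  · simp; rintro rfl; exact hb ha
  · simp; rintro rfl; exact ha hb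

lemma aux_total {V : Type*} (w : Sym2 V → ℝ) (D : Finset (Sym2 V)) :
    ∑ E ∈ D.powerset, ∏ e ∈ D, auxF w E e = 1 := by
  have h := Finset.prod_add w (fun e => 1 - w e) D
  simp only [add_sub_cancel, Finset.prod_const_one] at h
  rw [h]
  refine Finset.sum_congr rfl fun E hE => ?_
  rw [Finset.mem_powerset] at hE
  rw [← Finset.prod_sdiff hE, mul_comm]
  congr 1
  · exact Finset.prod_congr rfl fun e he => by simp [auxF, he]
  · exact Finset.prod_congr rfl fun e he => by
      simp only [auxF]; rw [if_neg (Finset.mem_sdiff.1 he).2]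

lemma aux_decomp {V : Type*} [Fintype V] (w : Sym2 V → ℝ) (v : V) (C : Finset V) (hv : v ∈ C) :
    ∑ E ∈ (auxD (Finset.univ : Finset V)).powerset.filter
      (fun E : Finset (Sym2 V) => Finset.univ.filter
        (fun a => (SimpleGraph.fromEdgeSet (E : Set (Sym2 V))).Reachable v a) = C),
      ∏ e ∈ auxD (Finset.univ : Finset V), auxF w E e =
    auxP w C * ∏ e ∈ auxX C, (1 - w e) := by
  have key : ∀ E : Finset (Sym2 V), (Finset.univ.filter
        (fun a => (SimpleGraph.fromEdgeSet (E : Set (Sym2 V))).Reachable v a) = C) ↔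
      ((SimpleGraph.fromEdgeSet (E : Set (Sym2 V))).induce (C : Set V)).Connected ∧
        ∀ a ∈ C, ∀ b, b ∉ C → s(a, b) ∉ E := by
    intro E
    have := aux_comp (SimpleGraph.fromEdgeSet (E : Set (Sym2 V))) v (C : Set V) (by simpa using hv)
    rw [Finset.ext_iff]
    simp only [Finset.mem_filter, Finset.mem_univ, true_and]
    simp only [Finset.mem_coe] at this
    rw [this]
    refine and_congr_right fun _ => ?_
    refine forall₂_congr fun a ha => forall₂_congr fun b hb => ?_
    simp only [SimpleGraph.fromEdgeSet_adj, Finset.mem_coe, not_and_or, not_not, ne_eq]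
    constructor
    · rintro (h | rfl)
      · exact h
      · exact absurd ha hb
    · exact Or.inl
  have ind : ∀ E E' : Finset (Sym2 V), (∀ e ∈ auxD C, e ∈ E ↔ e ∈ E') →
      (SimpleGraph.fromEdgeSet (E : Set (Sym2 V))).induce (C : Set V) =
      (SimpleGraph.fromEdgeSet (E' : Set (Sym2 V))).induce (C : Set V) := by
    intro E E' h
    ext ⟨a, ha⟩ ⟨b, hb⟩
    simp only [SimpleGraph.comap_adj, SimpleGraph.fromEdgeSet_adj, Finset.mem_coe,
      Function.Embedding.subtype_apply]
    refine and_congr_left fun hne => ?_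
    exact h _ ((mem_auxD _ _ _).2 ⟨⟨ha, hb⟩, hne⟩)
  have h12 : Disjoint (auxD C) (auxD Cᶜ) := by
    rw [Finset.disjoint_left]
    intro e
    induction e with | _ a b
    simp only [mem_auxD, Finset.mem_compl]; tauto
  have h1X : Disjoint (auxD C) (auxX C) := by
    rw [Finset.disjoint_left]
    intro e
    induction e with | _ a b
    simp only [mem_auxD, mem_auxX]; tauto
  have h2X : Disjoint (auxD Cᶜ) (auxX C) := by
    rw [Finset.disjoint_left]
    intro e
    induction e with | _ a b
    simp only [mem_auxD, mem_auxX, Finset.mem_compl]; tauto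
  have hsub : ∀ C' : Finset V, auxD C' ⊆ auxD Finset.univ := by
    intro C' e
    induction e with | _ a b
    simp only [mem_auxD, Finset.mem_univ]; tauto
  have hcov : ∀ e ∈ auxD (Finset.univ : Finset V), e ∉ auxX C → e ∈ auxD C ∨ e ∈ auxD Cᶜ := by
    intro e
    induction e with | _ a b
    simp only [mem_auxD, mem_auxX, Finset.mem_univ, Finset.mem_compl]; tauto
  have hX : ∀ E : Finset (Sym2 V), (∀ a ∈ C, ∀ b, b ∉ C → s(a, b) ∉ E) ↔ Disjoint (auxX C) E := by
    intro E
    rw [Finset.disjoint_left]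
    constructor
    · intro h e
      induction e with | _ a b
      rw [mem_auxX]
      rintro (⟨ha, hb⟩ | ⟨ha, hb⟩)
      · exact h _ ha _ hb
      · rw [Sym2.eq_swap]; exact h _ ha _ hb
    · intro h a ha b hb
      exact h ((mem_auxX _ _ _).2 (Or.inl ⟨ha, hb⟩))
  have hone : auxP w C = auxP w C * ∑ E ∈ (auxD Cᶜ).powerset, ∏ e ∈ auxD Cᶜ, auxF w E e := by
    rw [aux_total, mul_one]
  rw [hone, auxP, Finset.sum_mul_sum, ← Finset.sum_product',
    Finset.sum_mul]
  rw [Finset.disjoint_left] at h12 h1X h2X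
  refine Finset.sum_nbij' (fun E => (E ∩ auxD C, E ∩ auxD Cᶜ)) (fun p => p.1 ∪ p.2) ?_ ?_ ?_ ?_ ?_
  · intro E hE
    simp only [Finset.mem_filter, Finset.mem_powerset, key, Finset.mem_product] at hE ⊢
    refine ⟨⟨Finset.inter_subset_right, ?_⟩, Finset.inter_subset_right⟩
    rw [ind _ E]
    · exact hE.2.1
    · intro e he; simp [he]
  · rintro ⟨E1, E2⟩ hE
    simp only [Finset.mem_filter, Finset.mem_powerset, key, hX, Finset.mem_product] at hE ⊢
    obtain ⟨⟨a1, a2⟩, a3⟩ := hE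
    refine ⟨Finset.union_subset (a1.trans (hsub _)) (a3.trans (hsub _)), ?_, ?_⟩
    · rw [ind _ E1]
      · exact a2
      · intro e he
        simp only [Finset.mem_union, or_iff_left_iff_imp]
        intro h; exact absurd (a3 h) (h12 he)
    · rw [Finset.disjoint_left]
      intro e he
      simp only [Finset.mem_union]
      rintro (h | h)
      · exact h1X (a1 h) he
      · exact h2X (a3 h) he
  · intro E hE
    simp only [Finset.mem_filter, Finset.mem_powerset, key, hX] at hE ⊢
    rw [← Finset.inter_union_distrib_left, Finset.inter_eq_left]
    intro e he
    rw [Finset.mem_union]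
    exact hcov e (hE.1 he) (fun h => Finset.disjoint_left.1 hE.2.2 h he)
  · rintro ⟨E1, E2⟩ hE
    simp only [Finset.mem_filter, Finset.mem_powerset, Finset.mem_product] at hE ⊢
    obtain ⟨⟨a1, a2⟩, a3⟩ := hE
    ext e
    · simp only [Finset.mem_inter, Finset.mem_union]
      have := @a1 e; have := @a3 e; have := @h12 e; tauto
    · simp only [Finset.mem_inter, Finset.mem_union]
      have := @a1 e; have := @a3 e; have := @h12 e; tauto
  · intro E hE
    simp only [Finset.mem_filter, Finset.mem_powerset, key, hX] at hE ⊢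
    rw [aux_split C]
    congr 1
    · congr 1
      · refine Finset.prod_congr rfl fun e he => ?_
        simp [auxF, he]
      · refine Finset.prod_congr rfl fun e he => ?_
        simp [auxF, he]
    · refine Finset.prod_congr rfl fun e he => ?_
      simp [auxF, Finset.disjoint_left.1 hE.2.2 he]

lemma aux_main {V : Type*} [Fintype V] (w : Sym2 V → ℝ) (v : V) :
    ∑ C ∈ Finset.univ.filter (fun C : Finset V => v ∈ C),
      auxP w C * ∏ e ∈ auxX C, (1 - w e) = 1 := by
  refine Eq.trans ?_ (aux_total w (auxD (Finset.univ : Finset V)))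
  rw [← Finset.sum_fiberwise_of_maps_to (t := Finset.univ.filter (fun C : Finset V => v ∈ C))
    (g := fun E : Finset (Sym2 V) => Finset.univ.filter
        (fun a => (SimpleGraph.fromEdgeSet (E : Set (Sym2 V))).Reachable v a))]
  · refine Finset.sum_congr rfl fun C hC => ?_
    rw [aux_decomp w v C (by simpa using hC)]
  · intro E hE
    simp

lemma aux_cross {S V : Type*} [Fintype S] [Fintype V] (x : V → S) (q : Sym2 S → ℝ) (C : Finset V) :
    ∏ e ∈ auxX C, (1 - q (e.map x)) =
      ∏ s : S, ∏ t : S, (1 - q s(s, t)) ^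
        ((C.filter (fun a => x a = s)).card * (Cᶜ.filter (fun a => x a = t)).card) := by
  rw [auxX, Finset.prod_image, Finset.prod_product]
  · simp only [Sym2.map_mk]
    rw [← Finset.prod_fiberwise C x]
    refine Finset.prod_congr rfl fun s _ => ?_
    rw [Finset.prod_congr rfl (g := fun _ => ∏ b ∈ Cᶜ, (1 - q s(s, x b)))]
    · rw [Finset.prod_const, ← Finset.prod_fiberwise Cᶜ x, ← Finset.prod_pow]
      refine Finset.prod_congr rfl fun t _ => ?_
      rw [Finset.prod_congr rfl (g := fun _ => (1 - q s(s, t)))]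
      · rw [Finset.prod_const, ← pow_mul, mul_comm]
      · intro b hb
        rw [(Finset.mem_filter.1 hb).2]
    · intro a ha
      rw [(Finset.mem_filter.1 ha).2]
  · rintro ⟨a, b⟩ h1 ⟨c, d⟩ h2 h
    simp at h1 h2 h
    rcases h with ⟨rfl, rfl⟩ | ⟨rfl, rfl⟩
    · rfl
    · exact absurd h1.1 h2.2

lemma aux_cardA {n : ℕ} (a : Fin n) (h : ℕ) (hh : 1 ≤ h) :
    (((Finset.univ : Finset (Fin n)).powersetCard h).filter (fun A => a ∈ A)).card
      = (n - 1).choose (h - 1) := by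
  have : ((Finset.univ : Finset (Fin n)).erase a).card = n - 1 := by simp
  rw [← this, ← Finset.card_powersetCard]
  refine Finset.card_nbij' (fun A => A.erase a) (fun A => insert a A) ?_ ?_ ?_ ?_
  · intro A hA
    simp at hA ⊢
    refine ⟨Finset.erase_subset_erase _ (Finset.subset_univ _), ?_⟩
    rw [Finset.card_erase_of_mem hA.2, hA.1]
  · intro A hA
    simp [Finset.mem_powersetCard] at hA ⊢
    rw [Finset.card_insert_of_notMem, hA.2]
    · omega
    · intro h; exact (Finset.mem_erase.1 (hA.1 h)).1 rfl
  · intro A hA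
    simp at hA ⊢
    exact Finset.insert_erase hA.2
  · intro A hA
    simp [Finset.mem_powersetCard] at hA ⊢
    exact (fun h => (Finset.mem_erase.1 (hA.1 h)).1 rfl)

lemma aux_count {S : Type*} [Fintype S] (m : S → ℕ) (r : S) (v : Fin (m r)) (h : S → ℕ)
    (hh : 1 ≤ h r) :
    ((Finset.univ.filter (fun C : Finset (Σ s, Fin (m s)) => (⟨r, v⟩ : Σ s, Fin (m s)) ∈ C)).filter
      (fun C => (fun s => (C.filter (fun a => a.1 = s)).card) = h)).card =
    ∏ s : S, (m s - if s = r then 1 else 0).choose (h s - if s = r then 1 else 0) := by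
  have e : ∀ s, (m s - if s = r then 1 else 0).choose (h s - if s = r then 1 else 0) =
      (((Finset.univ : Finset (Fin (m s))).powersetCard (h s)).filter
        (fun A => ∀ hs : s = r, (hs ▸ v) ∈ A)).card := by
    intro s
    by_cases hs : s = r
    · subst hs
      simp only [if_true, forall_true_left]
      rw [← aux_cardA v (h s) hh]
    · simp [hs]
  simp only [e]
  rw [← Fintype.card_piFinset]
  have hc : ∀ (C : Finset (Σ s, Fin (m s))) (s : S), (C.filter (fun a => a.1 = s)).card =
      (Finset.univ.filter (fun i : Fin (m s) => (⟨s, i⟩ : Σ s, Fin (m s)) ∈ C)).card := by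
    intro C s
    symm
    apply Finset.card_bij (fun i _ => (⟨s, i⟩ : Σ s, Fin (m s)))
    · intro i hi; simpa using hi
    · intro i _ j _ hij; simpa using hij
    · rintro ⟨t, i⟩ hi
      simp at hi
      obtain ⟨hi, rfl⟩ := hi
      exact ⟨i, by simpa using hi, rfl⟩
  refine Finset.card_nbij'
    (fun C s => Finset.univ.filter (fun i : Fin (m s) => (⟨s, i⟩ : Σ s, Fin (m s)) ∈ C))
    (fun A => Finset.univ.sigma A) ?_ ?_ ?_ ?_
  · intro C hC
    simp at hC
    simp only [Finset.mem_coe, Fintype.mem_piFinset, Finset.mem_filter, Finset.mem_powersetCard]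
    intro s
    refine ⟨⟨Finset.subset_univ _, ?_⟩, ?_⟩
    · rw [← hc, ← hC.2]
    · rintro rfl; simpa using hC.1
  · intro A hA
    simp only [Finset.mem_coe, Fintype.mem_piFinset, Finset.mem_filter, Finset.mem_powersetCard] at hA
    simp only [Finset.mem_coe, Finset.mem_filter, Finset.mem_univ, true_and, Finset.mem_sigma]
    refine ⟨(hA r).2 rfl, ?_⟩
    funext s
    rw [hc, ← (hA s).1.2]
    congr 1
    ext i
    simp
  · intro C hC
    ext ⟨s, i⟩
    simp
  · intro A hA
    funext s
    ext i
    simp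

lemma aux_relabel {S V : Type*} [Fintype V] (n : ℕ) (y : Fin n → S) (x : V → S) (C : Finset V)
    (g : Fin n ≃ C) (hg : ∀ i, x (g i) = y i) (p : S → S → ℝ) (q : Sym2 S → ℝ)
    (hq : ∀ s t, q s(s, t) = p s t) :
    PConn n y p = auxP (fun e => q (e.map x)) C := by
  set φ : Fin n × Fin n → Sym2 V := fun z => s((g z.1 : V), (g z.2 : V)) with hφ
  have gi : ∀ i j, (g i : V) = (g j : V) ↔ i = j := by
    intro i j
    rw [Subtype.coe_inj, g.apply_eq_iff_eq]
  have hinj : Set.InjOn φ (upperPairs n : Set (Fin n × Fin n)) := by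
    rintro ⟨a, b⟩ h1 ⟨c, d⟩ h2 h
    simp only [upperPairs, Finset.coe_filter, Finset.mem_univ, true_and, Set.mem_ofPred_eq] at h1 h2
    simp only [hφ, Sym2.eq_iff, gi] at h
    rcases h with ⟨rfl, rfl⟩ | ⟨rfl, rfl⟩
    · rfl
    · exact absurd h1 (not_lt.2 h2.le)
  have himg : (upperPairs n).image φ = auxD C := by
    ext e
    induction e with | _ a b
    rw [mem_auxD]
    simp only [Finset.mem_image, upperPairs, Finset.mem_filter, Finset.mem_univ, true_and, hφ,
      Prod.exists, Sym2.eq_iff]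
    constructor
    · rintro ⟨i, j, hij, (⟨rfl, rfl⟩ | ⟨rfl, rfl⟩)⟩
      · exact ⟨⟨(g i).2, (g j).2⟩, fun h => hij.ne ((gi _ _).1 h)⟩
      · exact ⟨⟨(g j).2, (g i).2⟩, fun h => hij.ne ((gi _ _).1 h.symm)⟩
    · rintro ⟨⟨ha, hb⟩, hne⟩
      have e1 : ((g (g.symm ⟨a, ha⟩) : C) : V) = a := by simp
      have e2 : ((g (g.symm ⟨b, hb⟩) : C) : V) = b := by simp
      have hne' : g.symm ⟨a, ha⟩ ≠ g.symm ⟨b, hb⟩ := by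
        intro h
        rw [g.symm.apply_eq_iff_eq] at h
        exact hne (congrArg Subtype.val h)
      rcases lt_or_gt_of_ne hne' with h | h
      · exact ⟨_, _, h, Or.inl ⟨e1, e2⟩⟩
      · exact ⟨_, _, h, Or.inr ⟨e2, e1⟩⟩
  have hconn : ∀ E : Finset (Fin n × Fin n), (graphOf E).Connected ↔
      ((SimpleGraph.fromEdgeSet ((E.image φ : Finset (Sym2 V)) : Set (Sym2 V))).induce
        (C : Set V)).Connected := by
    intro E
    have iso : graphOf E ≃g ((SimpleGraph.fromEdgeSet
        ((E.image φ : Finset (Sym2 V)) : Set (Sym2 V))).induce (C : Set V)) := by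
      refine ⟨g, ?_⟩
      intro i j
      simp only [SimpleGraph.comap_adj, SimpleGraph.fromEdgeSet_adj, Finset.mem_coe,
        Function.Embedding.subtype_apply, graphOf, SimpleGraph.fromRel_adj, Finset.mem_image,
        hφ, Prod.exists, Sym2.eq_iff, ne_eq]
      erw [gi i j]
      rw [and_comm]
      refine and_congr_right fun _ => ?_
      constructor
      · rintro ⟨a, b, hab, (⟨h1, h2⟩ | ⟨h1, h2⟩)⟩
        · rw [(gi _ _).1 h1, (gi _ _).1 h2] at hab; exact Or.inl hab
        · rw [(gi _ _).1 h1, (gi _ _).1 h2] at hab; exact Or.inr hab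
      · rintro (h | h)
        · exact ⟨_, _, h, Or.inl ⟨rfl, rfl⟩⟩
        · exact ⟨_, _, h, Or.inr ⟨rfl, rfl⟩⟩
    exact iso.connected_iff
  rw [PConn, auxP]
  refine Finset.sum_nbij (fun E => E.image φ) ?_ ?_ ?_ ?_
  · intro E hE
    simp only [Finset.mem_filter, Finset.mem_powerset] at hE ⊢
    refine ⟨?_, (hconn E).1 hE.2⟩
    rw [← himg]
    exact Finset.image_subset_image hE.1
  · intro E hE E' hE' h
    simp only [Finset.coe_filter, Finset.mem_powerset, Set.mem_ofPred_eq] at hE hE'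
    have h' : φ '' (E : Set (Fin n × Fin n)) = φ '' (E' : Set (Fin n × Fin n)) := by
      have := congrArg (fun F : Finset (Sym2 V) => (F : Set (Sym2 V))) h
      simpa using this
    have := (hinj.image_eq_image_iff (Finset.coe_subset.2 hE.1) (Finset.coe_subset.2 hE'.1)).1 h'
    exact_mod_cast this
  · intro F hF
    simp only [Finset.coe_filter, Finset.mem_powerset, Set.mem_ofPred_eq] at hF
    obtain ⟨h1, h2⟩ := hF
    rw [← himg] at h1
    obtain ⟨E, hE, rfl⟩ := Finset.subset_image_iff.1 h1
    refine ⟨E, ?_, rfl⟩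
    simp only [Finset.coe_filter, Finset.mem_powerset, Set.mem_ofPred_eq]
    exact ⟨by exact_mod_cast hE, (hconn E).2 h2⟩
  · intro E hE
    simp only [Finset.mem_filter, Finset.mem_powerset] at hE
    rw [← himg, Finset.prod_image hinj, ← Finset.prod_sdiff hE.1, mul_comm]
    have hw : ∀ z : Fin n × Fin n, q ((φ z).map x) = p (y z.1) (y z.2) := by
      intro z
      simp only [hφ, Sym2.map_mk, hq, hg]
    congr 1
    · refine Finset.prod_congr rfl fun z hz => ?_
      rw [Finset.mem_sdiff] at hz
      simp only [auxF]
      rw [if_neg, hw]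
      intro h
      obtain ⟨z', hz', h⟩ := Finset.mem_image.1 h
      have := hinj (hE.1 hz') hz.1 h
      exact hz.2 (this ▸ hz')
    · refine Finset.prod_congr rfl fun z hz => ?_
      simp only [auxF]
      rw [if_pos (Finset.mem_image_of_mem _ hz), hw]

lemma aux_compat {S : Type*} [Fintype S] (k : S → ℕ) (s : S) :
    Fintype.card {i // compatVec k i = s} = k s := by
  have h1 : (compatList k).count s = k s := by
    rw [← Multiset.coe_count, compatList, Multiset.coe_toList, Multiset.count_sum']
    simp [Multiset.count_singleton]
  have h2 : Fintype.card {i // compatVec k i = s} =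
      Fintype.card {i // (compatList k).get i = s} := by
    refine Fintype.card_congr ((finCongr (compatList_length k).symm).subtypeEquiv ?_)
    intro i
    rfl
  rw [h2, ← h1, Fintype.card_subtype]
  have := Fin.card_filter_univ_eq_vector_get_eq_count s (⟨compatList k, rfl⟩ :
    List.Vector S (compatList k).length)
  exact this

lemma aux_equiv {S V : Type*} [Fintype S] (x : V → S) (C : Finset V) (k : S → ℕ)
    (hk : ∀ s, (C.filter (fun a => x a = s)).card = k s) :
    ∃ g : Fin (∑ s : S, k s) ≃ C, ∀ i, x (g i) = compatVec k i := by
  have hc : ∀ s, Nonempty ({i // compatVec k i = s} ≃ {a : C // x a = s}) := by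
    intro s
    refine Fintype.card_eq.1 ?_
    rw [aux_compat, ← hk, Fintype.card_subtype]
    symm
    refine Finset.card_bij (fun a _ => (a : V)) ?_ ?_ ?_
    · intro a ha; simpa using ha
    · intro a _ b _ h; exact Subtype.ext h
    · intro b hb
      simp only [Finset.mem_filter] at hb
      exact ⟨⟨b, hb.1⟩, by simpa using hb.2, rfl⟩
  let f := fun s => (hc s).some
  refine ⟨((Equiv.sigmaFiberEquiv (compatVec k)).symm.trans (Equiv.sigmaCongrRight f)).trans
    (Equiv.sigmaFiberEquiv (fun a : C => x a)), ?_⟩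
  intro i
  exact (f (compatVec k i) ⟨i, rfl⟩).2

/-- the cluster-exploration expansion identity. -/
theorem cluster_expansion_identity
    {S : Type*} [Fintype S] [DecidableEq S] [Nonempty S]
    (N : ℕ) (hN : 1 ≤ N)
    (κN : S → S → ℝ) (hκNsym : ∀ r s, κN r s = κN s r)
    (hκN0 : ∀ r s, 0 ≤ κN r s) (hκNle : ∀ r s, κN r s ≤ N)
    (m : S → ℕ) (r : S) (hm : 1 ≤ m r) :
    (∑ h ∈ Finset.Icc ((fun s => if s = r then 1 else 0) : S → ℕ) m,
      (∏ s : S, ((m s - if s = r then 1 else 0).choose (h s - if s = r then 1 else 0) : ℝ)) *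
        pN κN N h *
        ∏ s : S, ∏ t : S, (1 - κN s t / N) ^ (h s * (m t - h t))) = 1 := by
  have hinst : ‹DecidableEq S› = fun a b => Classical.propDecidable (a = b) :=
    Subsingleton.elim _ _
  subst hinst
  have hN' : (0 : ℝ) < N := by exact_mod_cast hN
  set q : Sym2 S → ℝ := Sym2.lift ⟨fun s t => κN s t / N, fun s t => by simp only [hκNsym s t]⟩ with hq
  have hp : (fun r s => min 1 (κN r s / N) : S → S → ℝ) = fun s t => κN s t / N := by
    funext s t
    exact min_eq_right ((div_le_one hN').2 (hκNle s t))
  set v : Σ s, Fin (m s) := ⟨r, ⟨0, hm⟩⟩ with hv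
  have main := aux_main (fun e : Sym2 (Σ s, Fin (m s)) => q (e.map Sigma.fst)) v
  have hcard : ∀ s, ((Finset.univ : Finset (Σ s, Fin (m s))).filter
      (fun a => a.1 = s)).card = m s := by
    intro s
    rw [← Fintype.card_subtype, Fintype.card_congr (Equiv.sigmaSubtype s)]
    simp
  refine Eq.trans ?_ main
  symm
  rw [← Finset.sum_fiberwise_of_maps_to
    (t := Finset.Icc ((fun s => if s = r then 1 else 0) : S → ℕ) m)
    (g := fun (C : Finset (Σ s, Fin (m s))) s => (C.filter (fun a => a.1 = s)).card)]
  · refine Finset.sum_congr rfl fun h hh => ?_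
    symm
    rw [Finset.mem_Icc] at hh
    have h1 : 1 ≤ h r := by simpa using hh.1 r
    have cnt := aux_count m r ⟨0, hm⟩ h h1
    have hterm : ∀ C ∈ ((Finset.univ.filter
        (fun C : Finset (Σ s, Fin (m s)) => v ∈ C)).filter
        (fun C => (fun s => (C.filter (fun a => a.1 = s)).card) = h)),
        auxP (fun e => q (e.map Sigma.fst)) C * ∏ e ∈ auxX C, (1 - q (e.map Sigma.fst)) =
        pN κN N h * ∏ s : S, ∏ t : S, (1 - κN s t / N) ^ (h s * (m t - h t)) := by
      intro C hC
      rw [Finset.mem_filter] at hC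
      have hk : ∀ s, (C.filter (fun a => a.1 = s)).card = h s := fun s => congrFun hC.2 s
      obtain ⟨g, hg⟩ := aux_equiv Sigma.fst C h hk
      rw [aux_cross, pN, hp, ← aux_relabel _ _ Sigma.fst C g hg (fun s t => κN s t / N) q
        (fun s t => rfl)]
      congr 1
      refine Finset.prod_congr rfl fun s _ => Finset.prod_congr rfl fun t _ => ?_
      have : (Cᶜ.filter (fun a => a.1 = t)).card = m t - h t := by
        rw [← hk, ← hcard]
        rw [← Finset.card_sdiff_of_subset
          (Finset.filter_subset_filter _ (Finset.subset_univ _))]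
        congr 1
        ext a
        simp only [Finset.mem_filter, Finset.mem_compl, Finset.mem_sdiff, Finset.mem_univ]
        tauto
      rw [hk, ← this]
      change (1 - κN s t / N) ^ _ = _
      congr!
    have e1 := Finset.sum_congr rfl hterm
    rw [Finset.sum_const, nsmul_eq_mul] at e1
    rw [mul_assoc]
    refine Eq.trans ?_ (Eq.trans e1.symm ?_)
    · congr 1
      rw [hv, cnt]
      push_cast
      refine Finset.prod_congr rfl fun s _ => ?_
      congr
    · refine Finset.sum_congr ?_ fun _ _ => rfl
      ext C
      simp
  · intro C hC
    simp only [Finset.mem_filter, Finset.mem_univ, true_and] at hC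
    rw [Finset.mem_Icc]
    constructor
    · intro s
      by_cases hs : s = r
      · subst hs
        simp only [if_true]
        exact Finset.card_pos.2 ⟨v, Finset.mem_filter.2 ⟨hC, rfl⟩⟩
      · simp [hs]
    · intro s
      simp only
      rw [← hcard s]
      exact Finset.card_le_card (Finset.filter_subset_filter _ (Finset.subset_univ _))


end
end
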